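/- arXiv:2202.10009 — 3 statements merged into one kernel-verified Lean document; each statement's English description precedes it below -/
import Mathlib

section
/- If a variety V has a Taylor term, then the following are equivalent: (1) V is congruence modular (Con(A) is a modular lattice for every A ∈ V); (2) the commutator is left distributive in V, i.e., [x + y, z] = [x,z] + [y,z] for all congruences on every algebra in V; (3) the commutator is right distributive in V, i.e., [x, y + z] = [x,y] + [x,z] for all congruences on every algebra in V. -/
/-- A (universal-algebraic) signature: a type of operation symbols with arities. -/
structure Sig where
  ops : Type
  arity : ops → ℕ

/-- An algebra for a signature: a carrier set with an interpretation of each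
operation symbol. -/
structure Alg (σ : Sig) where
  carrier : Type
  interp : ∀ f : σ.ops, (Fin (σ.arity f) → carrier) → carrier

/-- Terms over a signature with variables from `V`. -/
inductive Trm (σ : Sig) (V : Type) : Type
  | var : V → Trm σ V
  | op : (f : σ.ops) → (Fin (σ.arity f) → Trm σ V) → Trm σ V

/-- Evaluation of a term in an algebra under an assignment of the variables. -/
def Alg.evalTrm {σ : Sig} (A : Alg σ) {V : Type} (asg : V → A.carrier) :
    Trm σ V → A.carrier
  | .var v => asg v
  | .op f ts => A.interp f fun i => A.evalTrm asg (ts i)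

/-- A congruence on an algebra: an equivalence relation compatible with the
basic operations. -/
structure Congruence {σ : Sig} (A : Alg σ) where
  rel : A.carrier → A.carrier → Prop
  iseqv : Equivalence rel
  compat : ∀ (f : σ.ops) (a b : Fin (σ.arity f) → A.carrier),
    (∀ i, rel (a i) (b i)) → rel (A.interp f a) (A.interp f b)

namespace Congruence

variable {σ : Sig} {A : Alg σ}

theorem ext' {c d : Congruence A} (h : c.rel = d.rel) : c = d := by
  cases c; cases d; cases h; rfl

instance : PartialOrder (Congruence A) where
  le c d := ∀ a b, c.rel a b → d.rel a b
  le_refl c a b h := h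
  le_trans c d e h1 h2 a b h := h2 a b (h1 a b h)
  le_antisymm c d h1 h2 :=
    ext' (funext fun a => funext fun b => propext ⟨h1 a b, h2 a b⟩)

instance : InfSet (Congruence A) where
  sInf S :=
    { rel := fun a b => ∀ c ∈ S, c.rel a b
      iseqv := ⟨fun a c _ => c.iseqv.refl a,
                fun h c hc => c.iseqv.symm (h c hc),
                fun h1 h2 c hc => c.iseqv.trans (h1 c hc) (h2 c hc)⟩
      compat := fun f a b h c hc => c.compat f a b fun i => h i c hc }

/-- The congruences of an algebra form a complete lattice (`⊥` is the equality
congruence, `⊤` is the total congruence, meet is intersection). -/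
instance : CompleteLattice (Congruence A) :=
  completeLatticeOfInf _ fun S =>
    ⟨fun c hc a b h => h c hc, fun c hc a b h d hd => hc hd a b h⟩

end Congruence

/-- `Centralizes S T δ` is the centralizer relation `C(S,T;δ)`: for every
`S,T`-matrix `[[p,q],[r,s]]` (built from a term operation `t`, tuples `a S b`
and `u T v`), if `(p,q) ∈ δ` then `(r,s) ∈ δ`. -/
def Centralizes {σ : Sig} {A : Alg σ} (S T δ : Congruence A) : Prop :=
  ∀ (m n : ℕ) (t : Trm σ (Sum (Fin m) (Fin n)))
    (a b : Fin m → A.carrier) (u v : Fin n → A.carrier),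
    (∀ i, S.rel (a i) (b i)) → (∀ j, T.rel (u j) (v j)) →
    δ.rel (A.evalTrm (Sum.elim a u) t) (A.evalTrm (Sum.elim a v) t) →
    δ.rel (A.evalTrm (Sum.elim b u) t) (A.evalTrm (Sum.elim b v) t)

/-- The commC `[S,T]`: the least congruence `δ` with `C(S,T;δ)`. -/
def commC {σ : Sig} {A : Alg σ} (S T : Congruence A) : Congruence A :=
  sInf {δ | Centralizes S T δ}

/-- The relative commC `[S,T]_ε`: the intersection of all congruences
`γ ≥ ε` with `C(S,T;γ)`. -/
def relCommC {σ : Sig} {A : Alg σ} (S T ε : Congruence A) : Congruence A :=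
  sInf {γ | ε ≤ γ ∧ Centralizes S T γ}

/-- The congruence generated by a single pair `(x, y)`. -/
def cgPair {σ : Sig} (A : Alg σ) (x y : A.carrier) : Congruence A :=
  sInf {c | c.rel x y}

/-- Homomorphisms of algebras. -/
structure UAHom {σ : Sig} (A B : Alg σ) where
  toFun : A.carrier → B.carrier
  map_op : ∀ (f : σ.ops) (a : Fin (σ.arity f) → A.carrier),
    toFun (A.interp f a) = B.interp f (fun i => toFun (a i))

/-- The product of a family of algebras. -/
def prodAlg {σ : Sig} {I : Type} (F : I → Alg σ) : Alg σ where
  carrier := ∀ i, (F i).carrier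
  interp f a := fun i => (F i).interp f (fun j => a j i)

/-- A variety: a class of algebras of a fixed signature closed under
homomorphic images, subalgebras (here: isomorphic copies of subalgebras,
i.e. sources of injective homomorphisms), and arbitrary products. -/
structure Variety (σ : Sig) where
  Mem : Alg σ → Prop
  closed_hom : ∀ {A B : Alg σ}, Mem A →
    (∃ h : UAHom A B, Function.Surjective h.toFun) → Mem B
  closed_sub : ∀ {A B : Alg σ}, Mem A →
    (∃ h : UAHom B A, Function.Injective h.toFun) → Mem B
  closed_prod : ∀ {I : Type} (F : I → Alg σ), (∀ i, Mem (F i)) → Mem (prodAlg F)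

/-- The setoid associated with a congruence. -/
def Congruence.setoid {σ : Sig} {A : Alg σ} (c : Congruence A) :
    Setoid A.carrier := ⟨c.rel, c.iseqv⟩

/-- The quotient algebra of an algebra by a congruence. -/
noncomputable def quotAlg {σ : Sig} (A : Alg σ) (c : Congruence A) : Alg σ where
  carrier := Quotient c.setoid
  interp f a := Quotient.mk c.setoid (A.interp f fun i => (a i).out)

/-- `algOn A α` is the algebra `A(α)`: the subalgebra of `A × A` whose
universe is `α`. -/
def algOn {σ : Sig} (A : Alg σ) (α : Congruence A) : Alg σ where
  carrier := {p : A.carrier × A.carrier // α.rel p.1 p.2}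
  interp f a := ⟨(A.interp f fun i => (a i).1.1, A.interp f fun i => (a i).1.2),
    α.compat f _ _ fun i => (a i).2⟩

/-- The kernel of the first coordinate projection of `A(α)`. -/
def eta1 {σ : Sig} (A : Alg σ) (α : Congruence A) : Congruence (algOn A α) where
  rel p q := p.1.1 = q.1.1
  iseqv := ⟨fun _ => rfl, Eq.symm, Eq.trans⟩
  compat f a b h := congrArg (A.interp f) (funext h)

/-- The kernel of the second coordinate projection of `A(α)`. -/
def eta2 {σ : Sig} (A : Alg σ) (α : Congruence A) : Congruence (algOn A α) where
  rel p q := p.1.2 = q.1.2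
  iseqv := ⟨fun _ => rfl, Eq.symm, Eq.trans⟩
  compat f a b h := congrArg (A.interp f) (funext h)

/-- The congruence `Δ_{α,β}` on `A(α)` generated by the `β`-diagonal pairs. -/
def diagDelta {σ : Sig} (A : Alg σ) (α β : Congruence A) :
    Congruence (algOn A α) :=
  sInf {c | ∀ x z : A.carrier, β.rel x z →
    c.rel ⟨(x, x), α.iseqv.refl x⟩ ⟨(z, z), α.iseqv.refl z⟩}

/-- A pentagon (five-element sublattice isomorphic to `N₅`) in the congruence
lattice with bottom `z`, side element `β`, critical chain `δ < θ`, and top `α`. -/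
def IsPentagon {σ : Sig} {A : Alg σ} (z β δ θ α : Congruence A) : Prop :=
  δ < θ ∧ β ⊓ θ = z ∧ β ⊓ δ = z ∧ β ⊔ δ = α ∧ β ⊔ θ = α

/-- Two congruences permute: `c ∘ d = d ∘ c`. -/
def Permutes {σ : Sig} {A : Alg σ} (c d : Congruence A) : Prop :=
  ∀ a b : A.carrier, (∃ x, c.rel a x ∧ d.rel x b) ↔ (∃ x, d.rel a x ∧ c.rel x b)

/-- `T` is a Taylor term for the variety `V`: an idempotent term satisfying an
`i`-th place Taylor identity for every place `i`. -/
def IsTaylorTrm {σ : Sig} (V : Variety σ) {n : ℕ} (T : Trm σ (Fin n)) : Prop :=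
  0 < n ∧
  (∀ A : Alg σ, V.Mem A → ∀ c : A.carrier, A.evalTrm (fun _ => c) T = c) ∧
  (∀ i : Fin n, ∃ w z : Fin n → Bool, w i ≠ z i ∧
    ∀ A : Alg σ, V.Mem A → ∀ x y : A.carrier,
      A.evalTrm (fun j => cond (w j) x y) T = A.evalTrm (fun j => cond (z j) x y) T)

/-- `V` has a Taylor term. -/
def HasTaylorTrm {σ : Sig} (V : Variety σ) : Prop :=
  ∃ (n : ℕ) (T : Trm σ (Fin n)), IsTaylorTrm V T

/-- A congruence is abelian if `[α,α] = 0`. -/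
def IsAbelianCong {σ : Sig} {A : Alg σ} (α : Congruence A) : Prop :=
  commC α α = ⊥

/-- `d` is a weak difference term for `V`: `d(a,a,b) = b` and `d(a,b,b) = a`
whenever the pair `(a,b)` lies in an abelian congruence of a member of `V`. -/
def IsWeakDifferenceTrm {σ : Sig} (V : Variety σ) (d : Trm σ (Fin 3)) : Prop :=
  ∀ A : Alg σ, V.Mem A → ∀ α : Congruence A, IsAbelianCong α →
    ∀ a b : A.carrier, α.rel a b →
      A.evalTrm ![a, a, b] d = b ∧ A.evalTrm ![a, b, b] d = a

/-- `d` is a difference term for `V`: `V ⊨ d(x,x,y) ≈ y` and `d(a,b,b) = a`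
whenever the pair `(a,b)` lies in an abelian congruence of a member of `V`. -/
def IsDifferenceTrm {σ : Sig} (V : Variety σ) (d : Trm σ (Fin 3)) : Prop :=
  (∀ A : Alg σ, V.Mem A → ∀ a b : A.carrier, A.evalTrm ![a, a, b] d = b) ∧
  (∀ A : Alg σ, V.Mem A → ∀ α : Congruence A, IsAbelianCong α →
    ∀ a b : A.carrier, α.rel a b → A.evalTrm ![a, b, b] d = a)

/-- The commC is left distributive throughout `V`. -/
def CommLeftDistrib {σ : Sig} (V : Variety σ) : Prop :=
  ∀ A : Alg σ, V.Mem A → ∀ x y z : Congruence A,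
    commC (x ⊔ y) z = commC x z ⊔ commC y z

/-- The commC is right distributive throughout `V`. -/
def CommRightDistrib {σ : Sig} (V : Variety σ) : Prop :=
  ∀ A : Alg σ, V.Mem A → ∀ x y z : Congruence A,
    commC x (y ⊔ z) = commC x y ⊔ commC x z

/-- The commC is commutative throughout `V`. -/
def CommutativeCommutator {σ : Sig} (V : Variety σ) : Prop :=
  ∀ A : Alg σ, V.Mem A → ∀ x y : Congruence A, commC x y = commC y x

/-- `V` is congruence modular. -/
def CongruenceModular {σ : Sig} (V : Variety σ) : Prop :=
  ∀ A : Alg σ, V.Mem A → IsModularLattice (Congruence A)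

/-! ### Basic facts about congruences and homomorphisms -/

section Helpers

variable {σ : Sig} {A B : Alg σ}

theorem compat_of_update {r : A.carrier → A.carrier → Prop} (hr : Equivalence r)
    (h : ∀ (f : σ.ops) (a : Fin (σ.arity f) → A.carrier) (i : Fin (σ.arity f))
      (x y : A.carrier), r x y →
      r (A.interp f (Function.update a i x)) (A.interp f (Function.update a i y)))
    (f : σ.ops) (a b : Fin (σ.arity f) → A.carrier) (hab : ∀ i, r (a i) (b i)) :
    r (A.interp f a) (A.interp f b) := by
  classical
  have key : ∀ s : Finset (Fin (σ.arity f)),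
      r (A.interp f a) (A.interp f (s.piecewise b a)) := by
    intro s
    induction s using Finset.induction_on with
    | empty => simpa using hr.refl _
    | insert i s hi ih =>
      refine hr.trans ih ?_
      have h1 := h f (s.piecewise b a) i (a i) (b i) (hab i)
      rw [← Finset.piecewise_insert] at h1
      have h2 : Function.update (s.piecewise b a) i (a i) = s.piecewise b a := by
        apply Function.update_eq_self_iff.2
        simp [Finset.piecewise, hi]
      rw [h2] at h1
      exact h1
  simpa using key Finset.univ

/-- The congruence generated by a relation closed under basic translations. -/
def genCong (A : Alg σ) (R : A.carrier → A.carrier → Prop)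
    (h : ∀ (f : σ.ops) (a : Fin (σ.arity f) → A.carrier) (i : Fin (σ.arity f))
      (x y : A.carrier), R x y →
      R (A.interp f (Function.update a i x)) (A.interp f (Function.update a i y))) :
    Congruence A where
  rel := Relation.EqvGen R
  iseqv := Relation.EqvGen.is_equivalence R
  compat := compat_of_update (Relation.EqvGen.is_equivalence R) (by
    intro f a i x y hxy
    induction hxy with
    | rel x y hxy => exact .rel _ _ (h f a i x y hxy)
    | refl x => exact .refl _
    | symm x y _ ih => exact .symm _ _ ih
    | trans x y z _ _ ih1 ih2 => exact .trans _ _ _ ih1 ih2)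

theorem Congruence.update_compat (c : Congruence A) (f : σ.ops)
    (a : Fin (σ.arity f) → A.carrier) (i : Fin (σ.arity f)) {x y : A.carrier}
    (h : c.rel x y) :
    c.rel (A.interp f (Function.update a i x)) (A.interp f (Function.update a i y)) := by
  apply c.compat
  intro j
  by_cases hj : j = i
  · subst hj; simpa using h
  · simpa [hj] using c.iseqv.refl _

theorem Congruence.le_iff {c d : Congruence A} : c ≤ d ↔ ∀ a b, c.rel a b → d.rel a b := Iff.rfl

theorem eqvGen_le {X : Type} {R P : X → X → Prop} (hP : Equivalence P)
    (h : ∀ a b, R a b → P a b) {a b : X} (hab : Relation.EqvGen R a b) : P a b := by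
  induction hab with
  | rel x y hxy => exact h _ _ hxy
  | refl x => exact hP.refl _
  | symm x y _ ih => exact hP.symm ih
  | trans x y z _ _ ih1 ih2 => exact hP.trans ih1 ih2

theorem Congruence.sup_induction {c d : Congruence A} {P : A.carrier → A.carrier → Prop}
    (hP : Equivalence P) (hc : ∀ a b, c.rel a b → P a b) (hd : ∀ a b, d.rel a b → P a b)
    {a b : A.carrier} (h : (c ⊔ d).rel a b) : P a b := by
  let g : Congruence A := genCong A (fun x y => c.rel x y ∨ d.rel x y) (by
    rintro f a i x y (h | h)
    · exact Or.inl (c.update_compat f a i h)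
    · exact Or.inr (d.update_compat f a i h))
  have hg : c ⊔ d ≤ g :=
    sup_le (fun x y hxy => .rel _ _ (Or.inl hxy)) (fun x y hxy => .rel _ _ (Or.inr hxy))
  have := hg a b h
  exact eqvGen_le hP (fun x y hxy => hxy.elim (hc x y) (hd x y)) this

theorem Congruence.sup_left {c : Congruence A} (d : Congruence A) {a b : A.carrier}
    (h : c.rel a b) : (c ⊔ d).rel a b := (le_sup_left : c ≤ c ⊔ d) a b h

theorem Congruence.sup_right (c : Congruence A) {d : Congruence A} {a b : A.carrier}
    (h : d.rel a b) : (c ⊔ d).rel a b := (le_sup_right : d ≤ c ⊔ d) a b h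

/-- Explicit intersection. -/
def interCong (c d : Congruence A) : Congruence A where
  rel a b := c.rel a b ∧ d.rel a b
  iseqv := ⟨fun a => ⟨c.iseqv.refl a, d.iseqv.refl a⟩,
    fun h => ⟨c.iseqv.symm h.1, d.iseqv.symm h.2⟩,
    fun h k => ⟨c.iseqv.trans h.1 k.1, d.iseqv.trans h.2 k.2⟩⟩
  compat f a b h := ⟨c.compat f a b fun i => (h i).1, d.compat f a b fun i => (h i).2⟩

theorem Congruence.inf_rel {c d : Congruence A} {a b : A.carrier} :
    (c ⊓ d).rel a b ↔ c.rel a b ∧ d.rel a b := by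
  constructor
  · intro h
    exact ⟨(inf_le_left : c ⊓ d ≤ c) a b h, (inf_le_right : c ⊓ d ≤ d) a b h⟩
  · intro h
    have : interCong c d ≤ c ⊓ d := le_inf (fun _ _ h => h.1) (fun _ _ h => h.2)
    exact this a b h

theorem UAHom.eval (h : UAHom A B) {X : Type} (asg : X → A.carrier) (t : Trm σ X) :
    h.toFun (A.evalTrm asg t) = B.evalTrm (fun x => h.toFun (asg x)) t := by
  induction t with
  | var v => rfl
  | op f ts ih =>
    simp only [Alg.evalTrm, h.map_op]
    congr 1
    funext i
    exact ih i

theorem UAHom.eval_sum (h : UAHom A B) {X Y : Type} (a : X → A.carrier) (u : Y → A.carrier)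
    (t : Trm σ (Sum X Y)) :
    h.toFun (A.evalTrm (Sum.elim a u) t)
      = B.evalTrm (Sum.elim (fun i => h.toFun (a i)) (fun j => h.toFun (u j))) t := by
  rw [h.eval]
  congr 1
  funext x
  cases x <;> rfl

theorem Congruence.eval (c : Congruence A) {X : Type} {a b : X → A.carrier}
    (h : ∀ x, c.rel (a x) (b x)) (t : Trm σ X) :
    c.rel (A.evalTrm a t) (A.evalTrm b t) := by
  induction t with
  | var v => exact h v
  | op f ts ih => exact c.compat f _ _ ih

theorem Congruence.eval_sum (c : Congruence A) {X Y : Type} {a b : X → A.carrier}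
    {u v : Y → A.carrier}
    (h : ∀ x, c.rel (a x) (b x)) (h' : ∀ x, c.rel (u x) (v x)) (t : Trm σ (Sum X Y)) :
    c.rel (A.evalTrm (Sum.elim a u) t) (A.evalTrm (Sum.elim b v) t) := by
  apply c.eval
  rintro (x | x)
  · exact h x
  · exact h' x

/-- Pullback of a congruence along a homomorphism. -/
def comapCong (h : UAHom A B) (c : Congruence B) : Congruence A where
  rel x y := c.rel (h.toFun x) (h.toFun y)
  iseqv := ⟨fun _ => c.iseqv.refl _, fun h => c.iseqv.symm h, fun h k => c.iseqv.trans h k⟩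
  compat f a b hab := by
    rw [h.map_op, h.map_op]
    exact c.compat f _ _ hab

theorem comap_of_eq (h : UAHom A B) (c : Congruence B) {a b : A.carrier}
    (e : h.toFun a = h.toFun b) : (comapCong h c).rel a b := by
  change c.rel _ _
  rw [e]
  exact c.iseqv.refl _

/-- Renaming variables. -/
def Trm.ren {X Y : Type} (g : X → Y) : Trm σ X → Trm σ Y
  | .var v => .var (g v)
  | .op f ts => .op f fun i => (ts i).ren g

theorem eval_ren {X Y : Type} (g : X → Y) (asg : Y → A.carrier) (t : Trm σ X) :
    A.evalTrm asg (t.ren g) = A.evalTrm (fun x => asg (g x)) t := by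
  induction t with
  | var v => rfl
  | op f ts ih =>
    simp only [Trm.ren, Alg.evalTrm]
    congr 1
    funext i
    exact ih i

/-! ### Centralizer basics -/

theorem cent_of_left_le {S T δ : Congruence A} (h : S ≤ δ) : Centralizes S T δ := by
  intro m n t a b u v hab huv hd
  have h1 := δ.eval_sum (fun i => h _ _ (hab i)) (fun j => δ.iseqv.refl (u j)) t
  have h2 := δ.eval_sum (fun i => h _ _ (hab i)) (fun j => δ.iseqv.refl (v j)) t
  exact δ.iseqv.trans (δ.iseqv.symm h1) (δ.iseqv.trans hd h2)

theorem cent_of_right_le {S T δ : Congruence A} (h : T ≤ δ) : Centralizes S T δ := by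
  intro m n t a b u v hab huv hd
  exact δ.eval_sum (fun i => δ.iseqv.refl _) (fun j => h _ _ (huv j)) t

theorem cent_inf {S T δ ε : Congruence A} (h : Centralizes S T δ) (h' : Centralizes S T ε) :
    Centralizes S T (δ ⊓ ε) := by
  intro m n t a b u v hab huv hd
  rw [Congruence.inf_rel] at *
  exact ⟨h m n t a b u v hab huv hd.1, h' m n t a b u v hab huv hd.2⟩

theorem cent_commC (S T : Congruence A) : Centralizes S T (commC S T) := by
  intro m n t a b u v hab huv hd δ hδ
  exact hδ m n t a b u v hab huv (hd δ hδ)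

theorem commC_le {S T δ : Congruence A} (h : Centralizes S T δ) : commC S T ≤ δ :=
  sInf_le h

theorem cent_mono {S S' T T' δ : Congruence A} (hS : S ≤ S') (hT : T ≤ T')
    (h : Centralizes S' T' δ) : Centralizes S T δ := by
  intro m n t a b u v hab huv hd
  exact h m n t a b u v (fun i => hS _ _ (hab i)) (fun i => hT _ _ (huv i)) hd

/-! ### Quotients -/

/-- The projection onto the quotient. -/
noncomputable def quotHom (A : Alg σ) (ε : Congruence A) : UAHom A (quotAlg A ε) where
  toFun := Quotient.mk ε.setoid
  map_op f a := by
    apply Quotient.sound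
    apply ε.compat
    intro i
    have : ε.setoid.r (Quotient.mk ε.setoid (a i)).out (a i) :=
      Quotient.exact (Quotient.out_eq _)
    exact ε.iseqv.symm this

theorem quotHom_surj (A : Alg σ) (ε : Congruence A) :
    Function.Surjective (quotHom A ε).toFun := Quotient.mk_surjective

theorem quotHom_eq {ε : Congruence A} {a b : A.carrier} :
    (quotHom A ε).toFun a = (quotHom A ε).toFun b ↔ ε.rel a b :=
  ⟨fun h => Quotient.exact h, fun h => Quotient.sound h⟩

/-- Pushing a congruence above `ε` to the quotient. -/
def pushCong (ε c : Congruence A) (h : ε ≤ c) : Congruence (quotAlg A ε) where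
  rel x y := ∃ a b, (quotHom A ε).toFun a = x ∧ (quotHom A ε).toFun b = y ∧ c.rel a b
  iseqv := by
    refine ⟨?_, ?_, ?_⟩
    · intro x
      obtain ⟨a, rfl⟩ := quotHom_surj A ε x
      exact ⟨a, a, rfl, rfl, c.iseqv.refl a⟩
    · rintro x y ⟨a, b, ha, hb, hab⟩
      exact ⟨b, a, hb, ha, c.iseqv.symm hab⟩
    · rintro x y z ⟨a, b, ha, hb, hab⟩ ⟨b', d, hb', hd, hbd⟩
      refine ⟨a, d, ha, hd, c.iseqv.trans hab (c.iseqv.trans (h _ _ ?_) hbd)⟩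
      rw [← quotHom_eq, hb, hb']
  compat := by
    intro f x y hxy
    choose a b ha hb hab using hxy
    refine ⟨A.interp f a, A.interp f b, ?_, ?_, c.compat f a b hab⟩
    · rw [(quotHom A ε).map_op]; congr 1; funext i; exact ha i
    · rw [(quotHom A ε).map_op]; congr 1; funext i; exact hb i

theorem pushCong_rel {ε c : Congruence A} (h : ε ≤ c) {a b : A.carrier} :
    (pushCong ε c h).rel ((quotHom A ε).toFun a) ((quotHom A ε).toFun b) ↔ c.rel a b := by
  constructor
  · rintro ⟨a', b', ha, hb, hab⟩
    rw [quotHom_eq] at ha hb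
    exact c.iseqv.trans (c.iseqv.symm (h _ _ ha)) (c.iseqv.trans hab (h _ _ hb))
  · intro hab
    exact ⟨a, b, rfl, rfl, hab⟩

theorem push_cent {ε S T D : Congruence A} (hS : ε ≤ S) (hT : ε ≤ T) (hD : ε ≤ D)
    (h : Centralizes S T D) :
    Centralizes (pushCong ε S hS) (pushCong ε T hT) (pushCong ε D hD) := by
  intro m n t a b u v hab huv hd
  choose a' ha' using fun i => quotHom_surj A ε (a i)
  choose b' hb' using fun i => quotHom_surj A ε (b i)
  choose u' hu' using fun i => quotHom_surj A ε (u i)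
  choose v' hv' using fun i => quotHom_surj A ε (v i)
  obtain rfl : (fun i => (quotHom A ε).toFun (a' i)) = a := funext ha'
  obtain rfl : (fun i => (quotHom A ε).toFun (b' i)) = b := funext hb'
  obtain rfl : (fun i => (quotHom A ε).toFun (u' i)) = u := funext hu'
  obtain rfl : (fun i => (quotHom A ε).toFun (v' i)) = v := funext hv'
  rw [← UAHom.eval_sum, ← UAHom.eval_sum, pushCong_rel] at *
  exact h m n t a' b' u' v' (fun i => (pushCong_rel hS).1 (hab i))
    (fun i => (pushCong_rel hT).1 (huv i)) hd

theorem comap_cent (h : UAHom A B) {S T δ : Congruence B} (hc : Centralizes S T δ) :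
    Centralizes (comapCong h S) (comapCong h T) (comapCong h δ) := by
  intro m n t a b u v hab huv hd
  simp only [comapCong] at *
  rw [UAHom.eval_sum, UAHom.eval_sum] at *
  exact hc m n t _ _ _ _ hab huv hd

theorem left_rel {V : Variety σ} (hL : CommLeftDistrib V) (hA : V.Mem A)
    {ε S₁ S₂ T D₁ D₂ : Congruence A} (h1 : ε ≤ S₁) (h2 : ε ≤ S₂) (hT : ε ≤ T)
    (hD1 : ε ≤ D₁) (hD2 : ε ≤ D₂) (c1 : Centralizes S₁ T D₁) (c2 : Centralizes S₂ T D₂) :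
    ∃ κ : Congruence A, ε ≤ κ ∧ κ ≤ D₁ ⊔ D₂ ∧ Centralizes (S₁ ⊔ S₂) T κ := by
  have hQ : V.Mem (quotAlg A ε) := V.closed_hom hA ⟨quotHom A ε, quotHom_surj A ε⟩
  have e := hL _ hQ (pushCong ε S₁ h1) (pushCong ε S₂ h2) (pushCong ε T hT)
  have hD : ε ≤ D₁ ⊔ D₂ := hD1.trans le_sup_left
  refine ⟨comapCong (quotHom A ε) (commC (pushCong ε S₁ h1 ⊔ pushCong ε S₂ h2)
    (pushCong ε T hT)), ?_, ?_, ?_⟩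
  · intro a b hab
    exact comap_of_eq _ _ (quotHom_eq.2 hab)
  · have k1 : pushCong ε D₁ hD1 ≤ pushCong ε (D₁ ⊔ D₂) hD := by
      rintro x y ⟨a, b, ha, hb, hab⟩
      exact ⟨a, b, ha, hb, Congruence.sup_left _ hab⟩
    have k2 : pushCong ε D₂ hD2 ≤ pushCong ε (D₁ ⊔ D₂) hD := by
      rintro x y ⟨a, b, ha, hb, hab⟩
      exact ⟨a, b, ha, hb, Congruence.sup_right _ hab⟩
    have k := e.le.trans (sup_le ((commC_le (push_cent h1 hT hD1 c1)).trans k1)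
      ((commC_le (push_cent h2 hT hD2 c2)).trans k2))
    intro a b hab
    exact (pushCong_rel hD).1 (k _ _ hab)
  · refine cent_mono ?_ ?_ (comap_cent (quotHom A ε) (cent_commC _ _))
    · refine sup_le ?_ ?_
      · intro a b hab
        exact Congruence.sup_left _ ((pushCong_rel h1).2 hab)
      · intro a b hab
        exact Congruence.sup_right _ ((pushCong_rel h2).2 hab)
    · intro a b hab
      exact (pushCong_rel hT).2 hab

theorem right_rel {V : Variety σ} (hR : CommRightDistrib V) (hA : V.Mem A)
    {ε S₁ S₂ T D₁ D₂ : Congruence A} (h1 : ε ≤ S₁) (h2 : ε ≤ S₂) (hT : ε ≤ T)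
    (hD1 : ε ≤ D₁) (hD2 : ε ≤ D₂) (c1 : Centralizes T S₁ D₁) (c2 : Centralizes T S₂ D₂) :
    ∃ κ : Congruence A, ε ≤ κ ∧ κ ≤ D₁ ⊔ D₂ ∧ Centralizes T (S₁ ⊔ S₂) κ := by
  have hQ : V.Mem (quotAlg A ε) := V.closed_hom hA ⟨quotHom A ε, quotHom_surj A ε⟩
  have e := hR _ hQ (pushCong ε T hT) (pushCong ε S₁ h1) (pushCong ε S₂ h2)
  have hD : ε ≤ D₁ ⊔ D₂ := hD1.trans le_sup_left
  refine ⟨comapCong (quotHom A ε) (commC (pushCong ε T hT)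
    (pushCong ε S₁ h1 ⊔ pushCong ε S₂ h2)), ?_, ?_, ?_⟩
  · intro a b hab
    exact comap_of_eq _ _ (quotHom_eq.2 hab)
  · have k1 : pushCong ε D₁ hD1 ≤ pushCong ε (D₁ ⊔ D₂) hD := by
      rintro x y ⟨a, b, ha, hb, hab⟩
      exact ⟨a, b, ha, hb, Congruence.sup_left _ hab⟩
    have k2 : pushCong ε D₂ hD2 ≤ pushCong ε (D₁ ⊔ D₂) hD := by
      rintro x y ⟨a, b, ha, hb, hab⟩
      exact ⟨a, b, ha, hb, Congruence.sup_right _ hab⟩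
    have k := e.le.trans (sup_le ((commC_le (push_cent hT h1 hD1 c1)).trans k1)
      ((commC_le (push_cent hT h2 hD2 c2)).trans k2))
    intro a b hab
    exact (pushCong_rel hD).1 (k _ _ hab)
  · refine cent_mono ?_ ?_ (comap_cent (quotHom A ε) (cent_commC _ _))
    · intro a b hab
      exact (pushCong_rel hT).2 hab
    · refine sup_le ?_ ?_
      · intro a b hab
        exact Congruence.sup_left _ ((pushCong_rel h1).2 hab)
      · intro a b hab
        exact Congruence.sup_right _ ((pushCong_rel h2).2 hab)

/-! ### Subalgebras of the square -/

/-- The subalgebra of `A × A` given by a compatible relation. -/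
def relAlg (A : Alg σ) (Φ : A.carrier → A.carrier → Prop)
    (hΦ : ∀ (f : σ.ops) (a b : Fin (σ.arity f) → A.carrier),
      (∀ i, Φ (a i) (b i)) → Φ (A.interp f a) (A.interp f b)) : Alg σ where
  carrier := {p : A.carrier × A.carrier // Φ p.1 p.2}
  interp f a := ⟨(A.interp f fun i => (a i).1.1, A.interp f fun i => (a i).1.2),
    hΦ f _ _ fun i => (a i).2⟩

/-- First projection. -/
def relFst (A : Alg σ) (Φ : A.carrier → A.carrier → Prop)
    (hΦ : ∀ (f : σ.ops) (a b : Fin (σ.arity f) → A.carrier),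
      (∀ i, Φ (a i) (b i)) → Φ (A.interp f a) (A.interp f b)) : UAHom (relAlg A Φ hΦ) A where
  toFun p := p.1.1
  map_op _ _ := rfl

/-- Second projection. -/
def relSnd (A : Alg σ) (Φ : A.carrier → A.carrier → Prop)
    (hΦ : ∀ (f : σ.ops) (a b : Fin (σ.arity f) → A.carrier),
      (∀ i, Φ (a i) (b i)) → Φ (A.interp f a) (A.interp f b)) : UAHom (relAlg A Φ hΦ) A where
  toFun p := p.1.2
  map_op _ _ := rfl

theorem relAlg_mem {V : Variety σ} (hA : V.Mem A) (Φ : A.carrier → A.carrier → Prop)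
    (hΦ : ∀ (f : σ.ops) (a b : Fin (σ.arity f) → A.carrier),
      (∀ i, Φ (a i) (b i)) → Φ (A.interp f a) (A.interp f b)) :
    V.Mem (relAlg A Φ hΦ) := by
  refine V.closed_sub (V.closed_prod (I := Bool) (fun _ => A) (fun _ => hA))
    ⟨⟨fun p b => cond b p.1.1 p.1.2, ?_⟩, ?_⟩
  · intro f a
    funext b
    cases b <;> rfl
  · intro p q h
    apply Subtype.ext
    exact Prod.ext (congrFun h true) (congrFun h false)

theorem algOn_mem {V : Variety σ} (hA : V.Mem A) (α : Congruence A) : V.Mem (algOn A α) :=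
  relAlg_mem hA α.rel α.compat

/-- First projection of `A(α)`. -/
def pr1 (A : Alg σ) (α : Congruence A) : UAHom (algOn A α) A where
  toFun p := p.1.1
  map_op _ _ := rfl

/-- Second projection of `A(α)`. -/
def pr2 (A : Alg σ) (α : Congruence A) : UAHom (algOn A α) A where
  toFun p := p.1.2
  map_op _ _ := rfl

/-- The diagonal embedding. -/
def diagHom (A : Alg σ) (α : Congruence A) : UAHom A (algOn A α) where
  toFun a := ⟨(a, a), α.iseqv.refl a⟩
  map_op _ _ := rfl

/-- The congruence `c` on the first coordinates. -/
def on1 (α c : Congruence A) : Congruence (algOn A α) := comapCong (pr1 A α) c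

/-- The congruence `c` on the second coordinates. -/
def on2 (α c : Congruence A) : Congruence (algOn A α) := comapCong (pr2 A α) c

/-- Join of the two one-sided versions of `δ` inside `θ × θ`. -/
def dhat (β θ δ : Congruence A) : Congruence (algOn A β) :=
  (on2 β δ ⊓ (on1 β θ ⊓ on2 β θ)) ⊔ (on1 β δ ⊓ (on1 β θ ⊓ on2 β θ))

theorem dhat_left {β θ δ : Congruence A} {X Y : (algOn A β).carrier}
    (h : δ.rel X.1.1 Y.1.1) (h1 : θ.rel X.1.1 Y.1.1) (h2 : θ.rel X.1.2 Y.1.2) :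
    (dhat β θ δ).rel X Y :=
  Congruence.sup_right _ (Congruence.inf_rel.2 ⟨h, Congruence.inf_rel.2 ⟨h1, h2⟩⟩)

theorem dhat_right {β θ δ : Congruence A} {X Y : (algOn A β).carrier}
    (h : δ.rel X.1.2 Y.1.2) (h1 : θ.rel X.1.1 Y.1.1) (h2 : θ.rel X.1.2 Y.1.2) :
    (dhat β θ δ).rel X Y :=
  Congruence.sup_left _ (Congruence.inf_rel.2 ⟨h, Congruence.inf_rel.2 ⟨h1, h2⟩⟩)

theorem dhat_le {β θ δ : Congruence A} : dhat β θ δ ≤ on1 β θ ⊓ on2 β θ :=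
  sup_le inf_le_right inf_le_right

theorem dhat_diag {β θ δ : Congruence A} (hβ : β ⊓ θ ≤ δ) (hδ : δ ≤ θ) {x y : A.carrier}
    (h : (dhat β θ δ).rel ((diagHom A β).toFun x) ((diagHom A β).toFun y)) : δ.rel x y := by
  have key := Congruence.sup_induction (A := algOn A β)
    (P := fun X Y => (δ.rel X.1.1 X.1.2 ↔ δ.rel Y.1.1 Y.1.2) ∧
      (δ.rel X.1.1 X.1.2 → δ.rel X.1.1 Y.1.1)) ?_ ?_ ?_ h
  · exact key.2 (δ.iseqv.refl _)
  · refine ⟨fun X => ⟨Iff.rfl, fun _ => δ.iseqv.refl _⟩, ?_, ?_⟩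
    · intro X Y h
      exact ⟨h.1.symm, fun g => δ.iseqv.symm (h.2 (h.1.2 g))⟩
    · intro X Y Z h k
      exact ⟨h.1.trans k.1, fun g => δ.iseqv.trans (h.2 g) (k.2 (h.1.1 g))⟩
  · have good : ∀ X Y : (algOn A β).carrier, δ.rel X.1.2 Y.1.2 → θ.rel X.1.1 Y.1.1 →
        δ.rel X.1.1 X.1.2 → δ.rel Y.1.1 Y.1.2 := by
      intro X Y h1 h2 h3
      apply hβ
      refine Congruence.inf_rel.2 ⟨Y.2, ?_⟩
      exact θ.iseqv.trans (θ.iseqv.symm h2) (θ.iseqv.trans (hδ _ _ h3) (hδ _ _ h1))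
    intro X Y hXY
    obtain ⟨h1, h2⟩ := Congruence.inf_rel.1 hXY
    have h3 := (Congruence.inf_rel.1 h2).1
    change δ.rel X.1.2 Y.1.2 at h1
    change θ.rel X.1.1 Y.1.1 at h3
    refine ⟨⟨good X Y h1 h3, good Y X (δ.iseqv.symm h1) (θ.iseqv.symm h3)⟩, fun g => ?_⟩
    exact δ.iseqv.trans g (δ.iseqv.trans h1 (δ.iseqv.symm (good X Y h1 h3 g)))
  · have good : ∀ X Y : (algOn A β).carrier, δ.rel X.1.1 Y.1.1 → θ.rel X.1.2 Y.1.2 →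
        δ.rel X.1.1 X.1.2 → δ.rel Y.1.1 Y.1.2 := by
      intro X Y h1 h2 h3
      apply hβ
      refine Congruence.inf_rel.2 ⟨Y.2, ?_⟩
      exact θ.iseqv.trans (θ.iseqv.symm (hδ _ _ h1)) (θ.iseqv.trans (hδ _ _ h3) h2)
    intro X Y hXY
    obtain ⟨h1, h2⟩ := Congruence.inf_rel.1 hXY
    have h3 := (Congruence.inf_rel.1 h2).2
    change δ.rel X.1.1 Y.1.1 at h1
    change θ.rel X.1.2 Y.1.2 at h3
    exact ⟨⟨good X Y h1 h3, good Y X (δ.iseqv.symm h1) (θ.iseqv.symm h3)⟩, fun _ => h1⟩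

theorem diag_beta {β δ : Congruence A} {a b : A.carrier} (hab : β.rel a b) :
    ((eta2 A β ⊔ (on1 β δ ⊓ on2 β δ)) ⊔ (eta1 A β ⊔ (on1 β δ ⊓ on2 β δ))).rel
      ((diagHom A β).toFun a) ((diagHom A β).toFun b) := by
  let M : (algOn A β).carrier := ⟨(b, a), β.iseqv.symm hab⟩
  refine Congruence.iseqv _ |>.trans (y := M) ?_ ?_
  · exact Congruence.sup_left _ (Congruence.sup_left _ rfl)
  · exact Congruence.sup_right _ (Congruence.sup_left _ rfl)

theorem zz_le1 {β δ : Congruence A} : eta1 A β ⊔ (on1 β δ ⊓ on2 β δ) ≤ on1 β δ := by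
  refine sup_le ?_ inf_le_left
  intro X Y h
  change δ.rel X.1.1 Y.1.1
  rw [show X.1.1 = Y.1.1 from h]
  exact δ.iseqv.refl _

theorem zz_le2 {β δ : Congruence A} : eta2 A β ⊔ (on1 β δ ⊓ on2 β δ) ≤ on2 β δ := by
  refine sup_le ?_ inf_le_right
  intro X Y h
  change δ.rel X.1.2 Y.1.2
  rw [show X.1.2 = Y.1.2 from h]
  exact δ.iseqv.refl _

theorem on_mono {β δ θ : Congruence A} (h : δ ≤ θ) :
    on1 β δ ⊓ on2 β δ ≤ on1 β θ ⊓ on2 β θ :=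
  inf_le_inf (fun _ _ k => h _ _ k) (fun _ _ k => h _ _ k)

/-- Left distributivity gives `C(β,θ;δ)` whenever `β ∧ θ ≤ δ ≤ θ`. -/
theorem left_cent {V : Variety σ} (hL : CommLeftDistrib V) (hA : V.Mem A)
    {β θ δ : Congruence A} (hβ : β ⊓ θ ≤ δ) (hδ : δ ≤ θ) : Centralizes β θ δ := by
  obtain ⟨κ, hκ1, hκ2, hκ⟩ := left_rel hL (algOn_mem hA β)
    (ε := on1 β δ ⊓ on2 β δ) (S₁ := eta2 A β ⊔ (on1 β δ ⊓ on2 β δ))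
    (S₂ := eta1 A β ⊔ (on1 β δ ⊓ on2 β δ)) (T := on1 β θ ⊓ on2 β θ)
    (D₁ := on2 β δ ⊓ (on1 β θ ⊓ on2 β θ)) (D₂ := on1 β δ ⊓ (on1 β θ ⊓ on2 β θ))
    le_sup_right le_sup_right (on_mono hδ) (le_inf inf_le_right (on_mono hδ))
    (le_inf inf_le_left (on_mono hδ))
    (cent_inf (cent_of_left_le zz_le2) (cent_of_right_le le_rfl))
    (cent_inf (cent_of_left_le zz_le1) (cent_of_right_le le_rfl))
  have hc := comap_cent (diagHom A β) hκ
  intro m n t a b u v hab huv hd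
  apply dhat_diag hβ hδ
  refine hκ2 _ _ (hc m n t a b u v (fun i => diag_beta (hab i)) (fun j => ?_) ?_)
  · exact Congruence.inf_rel.2 ⟨huv j, huv j⟩
  · exact hκ1 _ _ (Congruence.inf_rel.2 ⟨hd, hd⟩)

theorem right_cent {V : Variety σ} (hR : CommRightDistrib V) (hA : V.Mem A)
    {β θ δ : Congruence A} (hβ : β ⊓ θ ≤ δ) (hδ : δ ≤ θ) : Centralizes θ (β ⊔ δ) δ := by
  obtain ⟨κ, hκ1, hκ2, hκ⟩ := right_rel hR (algOn_mem hA β)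
    (ε := on1 β δ ⊓ on2 β δ) (S₁ := eta2 A β ⊔ (on1 β δ ⊓ on2 β δ))
    (S₂ := eta1 A β ⊔ (on1 β δ ⊓ on2 β δ)) (T := on1 β θ ⊓ on2 β θ)
    (D₁ := on2 β δ ⊓ (on1 β θ ⊓ on2 β θ)) (D₂ := on1 β δ ⊓ (on1 β θ ⊓ on2 β θ))
    le_sup_right le_sup_right (on_mono hδ) (le_inf inf_le_right (on_mono hδ))
    (le_inf inf_le_left (on_mono hδ))
    (cent_inf (cent_of_right_le zz_le2) (cent_of_left_le le_rfl))
    (cent_inf (cent_of_right_le zz_le1) (cent_of_left_le le_rfl))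
  have hc := comap_cent (diagHom A β) hκ
  have hle : β ⊔ δ ≤ comapCong (diagHom A β)
      ((eta2 A β ⊔ (on1 β δ ⊓ on2 β δ)) ⊔ (eta1 A β ⊔ (on1 β δ ⊓ on2 β δ))) := by
    refine sup_le (fun a b hab => diag_beta hab) (fun a b hab => ?_)
    exact Congruence.sup_left _ (Congruence.sup_right _ (Congruence.inf_rel.2 ⟨hab, hab⟩))
  intro m n t a b u v hab huv hd
  apply dhat_diag hβ hδ
  refine hκ2 _ _ (hc m n t a b u v (fun i => ?_) (fun j => hle _ _ (huv j)) ?_)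
  · exact Congruence.inf_rel.2 ⟨hab i, hab i⟩
  · exact hκ1 _ _ (Congruence.inf_rel.2 ⟨hd, hd⟩)

/-- The translation property extracted from either distributive law. -/
def TransProp (V : Variety σ) : Prop :=
  ∀ A : Alg σ, V.Mem A → ∀ β θ γ : Congruence A, β ⊓ θ ≤ γ → γ ≤ θ →
    ∀ (m n : ℕ) (t : Trm σ (Sum (Fin m) (Fin n))) (a b : Fin m → A.carrier)
      (u v u' v' : Fin n → A.carrier), (∀ i, β.rel (a i) (b i)) →
      (∀ j, θ.rel (u j) (v j)) → (∀ j, β.rel (u j) (u' j)) → (∀ j, β.rel (v j) (v' j)) →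
      (∀ j, γ.rel (u' j) (v' j)) →
      γ.rel (A.evalTrm (Sum.elim a u) t) (A.evalTrm (Sum.elim a v) t) →
      γ.rel (A.evalTrm (Sum.elim b u) t) (A.evalTrm (Sum.elim b v) t)

theorem transProp_of_left {V : Variety σ} (hL : CommLeftDistrib V) : TransProp V := by
  intro A hA β θ γ h1 h2 m n t a b u v u' v' hab huv _ _ _ hd
  exact left_cent hL hA h1 h2 m n t a b u v hab huv hd

theorem transProp_of_right {V : Variety σ} (hR : CommRightDistrib V) : TransProp V := by
  intro A hA β θ γ h1 h2 m n t a b u v u' v' hab huv hu hv hγ hd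
  have hc := right_cent hR (algOn_mem hA β) (β := eta1 A β) (θ := on2 β θ)
    (δ := dhat β θ γ) ?_ (dhat_le.trans inf_le_right)
  · let a1 : Fin m → (algOn A β).carrier := fun i => ⟨(a i, b i), hab i⟩
    let b1 : Fin m → (algOn A β).carrier := fun i => (diagHom A β).toFun (b i)
    let u1 : Fin n → (algOn A β).carrier := fun i => (diagHom A β).toFun (u i)
    let v1 : Fin n → (algOn A β).carrier := fun i => (diagHom A β).toFun (v i)
    have hc1 := hc m n t a1 b1 u1 v1 (fun i => θ.iseqv.refl (b i)) ?_ ?_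
    · have e1 : (algOn A β).evalTrm (Sum.elim b1 u1) t
          = (diagHom A β).toFun (A.evalTrm (Sum.elim b u) t) :=
        ((diagHom A β).eval_sum b u t).symm
      have e2 : (algOn A β).evalTrm (Sum.elim b1 v1) t
          = (diagHom A β).toFun (A.evalTrm (Sum.elim b v) t) :=
        ((diagHom A β).eval_sum b v t).symm
      rw [e1, e2] at hc1
      exact dhat_diag h1 h2 hc1
    · intro j
      let M1 : (algOn A β).carrier := ⟨(u j, u' j), hu j⟩
      let M2 : (algOn A β).carrier := ⟨(v j, v' j), hv j⟩
      refine Congruence.iseqv _ |>.trans (y := M1) (Congruence.sup_left _ rfl) ?_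
      refine Congruence.iseqv _ |>.trans (y := M2) (Congruence.sup_right _ ?_)
        (Congruence.sup_left _ rfl)
      exact dhat_right (hγ j) (huv j) (h2 _ _ (hγ j))
    · have p1 := fun (w : Fin n → (algOn A β).carrier) => (pr1 A β).eval_sum a1 w t
      have p2 := fun (w : Fin n → (algOn A β).carrier) => (pr2 A β).eval_sum a1 w t
      have q1 : γ.rel ((pr1 A β).toFun ((algOn A β).evalTrm (Sum.elim a1 u1) t))
          ((pr1 A β).toFun ((algOn A β).evalTrm (Sum.elim a1 v1) t)) := by
        rw [p1, p1]; exact hd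
      have q2 : θ.rel ((pr2 A β).toFun ((algOn A β).evalTrm (Sum.elim a1 u1) t))
          ((pr2 A β).toFun ((algOn A β).evalTrm (Sum.elim a1 v1) t)) := by
        rw [p2, p2]
        exact θ.eval_sum (fun i => θ.iseqv.refl _) huv t
      exact dhat_left q1 (h2 _ _ q1) q2
  · intro X Y h
    obtain ⟨e, h⟩ := Congruence.inf_rel.1 h
    change X.1.1 = Y.1.1 at e
    change θ.rel X.1.2 Y.1.2 at h
    have hb : β.rel X.1.2 Y.1.2 := by
      refine β.iseqv.trans (β.iseqv.symm X.2) ?_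
      rw [e]
      exact Y.2
    refine dhat_right (h1 _ _ (Congruence.inf_rel.2 ⟨hb, h⟩)) ?_ h
    rw [e]
    exact θ.iseqv.refl _

/-- The Shifting Lemma for a variety. -/
def Shifting (V : Variety σ) : Prop :=
  ∀ A : Alg σ, V.Mem A → ∀ β θ γ : Congruence A, β ⊓ θ ≤ γ →
    ∀ p q p' q' : A.carrier, β.rel p p' → β.rel q q' → θ.rel p q → θ.rel p' q' →
      γ.rel p' q' → γ.rel p q

theorem shifting_aux {V : Variety σ} (hT : HasTaylorTrm V) (hV : TransProp V)
    (hA : V.Mem A) {β θ γ : Congruence A} (h1 : β ⊓ θ ≤ γ) (h2 : γ ≤ θ)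
    {p q p' q' : A.carrier} (hp : β.rel p p') (hq : β.rel q q') (hpq : θ.rel p q)
    (hγ : γ.rel p' q') : γ.rel p q := by
  classical
  obtain ⟨n, T, -, hid, hTay⟩ := hT
  let g : Bool → Bool → A.carrier := fun w s => cond w (cond s q p) (cond s q' p')
  have gβ : ∀ w w' s, β.rel (g w s) (g w' s) := by
    rintro (_ | _) (_ | _) (_ | _) <;>
      first
      | exact β.iseqv.refl _
      | assumption
      | (apply β.iseqv.symm; assumption)
  have gγ : ∀ s s', γ.rel (g false s) (g false s') := by
    rintro (_ | _) (_ | _) <;>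
      first
      | exact γ.iseqv.refl _
      | assumption
      | (apply γ.iseqv.symm; assumption)
  have gθ : ∀ w s s', θ.rel (g w s) (g w s') := by
    rintro (_ | _) s s'
    · exact h2 _ _ (gγ s s')
    · revert s s'
      rintro (_ | _) (_ | _) <;>
      first
      | exact θ.iseqv.refl _
      | assumption
      | (apply θ.iseqv.symm; assumption)
  let Ev : (Fin n → Bool) → (Fin n → Bool) → A.carrier :=
    fun w s => A.evalTrm (fun j => g (w j) (s j)) T
  have main : ∀ (i : Fin n) (w z : Fin n → Bool), w i = true → z i = false →
      (∀ x y : A.carrier,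
        A.evalTrm (fun j => cond (w j) x y) T = A.evalTrm (fun j => cond (z j) x y) T) →
      ∀ s : Fin n → Bool, ∀ c : Bool,
        γ.rel (Ev (fun _ => true) s) (Ev (fun _ => true) (Function.update s i c)) := by
    intro i w z hw hz hid2 s c
    have c1 : ∀ s, γ.rel (Ev w s) (Ev z s) := by
      intro s
      apply h1
      refine Congruence.inf_rel.2 ⟨β.eval (fun j => gβ _ _ _) T, ?_⟩
      have e : Ev w (fun _ => false) = Ev z (fun _ => false) := hid2 p p'
      have k1 : θ.rel (Ev w s) (Ev w (fun _ => false)) := θ.eval (fun j => gθ _ _ _) T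
      have k2 : θ.rel (Ev z (fun _ => false)) (Ev z s) := θ.eval (fun j => gθ _ _ _) T
      rw [e] at k1
      exact θ.iseqv.trans k1 k2
    have c2 : γ.rel (Ev z s) (Ev z (Function.update s i c)) := by
      refine γ.eval (fun j => ?_) T
      by_cases hj : j = i
      · subst hj
        rw [hz]
        exact gγ _ _
      · simpa [hj] using γ.iseqv.refl _
    have c3 : γ.rel (Ev w s) (Ev w (Function.update s i c)) :=
      γ.iseqv.trans (c1 _) (γ.iseqv.trans c2 (γ.iseqv.symm (c1 _)))
    have tr := hV A hA β θ γ h1 h2 n 1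
      (T.ren (fun j => if j = i then Sum.inr 0 else Sum.inl j))
      (fun j => g (w j) (s j)) (fun j => g true (s j))
      (fun _ => g true (s i)) (fun _ => g true c)
      (fun _ => g false (s i)) (fun _ => g false c)
      (fun j => gβ _ _ _) (fun _ => gθ _ _ _) (fun _ => gβ _ _ _) (fun _ => gβ _ _ _)
      (fun _ => gγ _ _)
    rw [eval_ren, eval_ren, eval_ren, eval_ren] at tr
    have hh : ∀ (w' : Fin n → Bool), w' i = true → ∀ d : Bool,
        (fun x => Sum.elim (fun j => g (w' j) (s j)) (fun _ : Fin 1 => g true d)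
          (if x = i then Sum.inr 0 else Sum.inl x))
          = fun j => g (w' j) (Function.update s i d j) := by
      intro w' hw' d
      funext j
      by_cases hj : j = i
      · subst hj; simp [hw']
      · simp [hj]
    have e1 := hh w hw (s i)
    have e2 := hh w hw c
    have e3 := hh (fun _ => true) rfl (s i)
    have e4 := hh (fun _ => true) rfl c
    rw [Function.update_eq_self] at e1 e3
    rw [e1, e2, e3, e4] at tr
    exact tr c3
  have step : ∀ (i : Fin n) (s : Fin n → Bool) (c : Bool),
      γ.rel (Ev (fun _ => true) s) (Ev (fun _ => true) (Function.update s i c)) := by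
    intro i s c
    obtain ⟨w, z, hwz, hid2⟩ := hTay i
    cases hw : w i with
    | true =>
      refine main i w z hw ?_ (fun x y => hid2 A hA x y) s c
      rw [hw] at hwz
      simpa using hwz.symm
    | false =>
      refine main i z w ?_ hw (fun x y => (hid2 A hA x y).symm) s c
      rw [hw] at hwz
      simpa using hwz.symm
  have tel : ∀ S : Finset (Fin n), γ.rel (Ev (fun _ => true) (fun _ => false))
      (Ev (fun _ => true) (S.piecewise (fun _ => true) (fun _ => false))) := by
    intro S
    induction S using Finset.induction_on with
    | empty => simpa using γ.iseqv.refl _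
    | insert i S hi ih =>
      refine γ.iseqv.trans ih ?_
      rw [Finset.piecewise_insert]
      exact step _ _ _
  have fin := tel Finset.univ
  rw [Finset.piecewise_univ] at fin
  have e1 : Ev (fun _ => true) (fun _ => false) = p := hid A hA p
  have e2 : Ev (fun _ => true) (fun _ => true) = q := hid A hA q
  rwa [e1, e2] at fin

theorem shifting_of_trans {V : Variety σ} (hT : HasTaylorTrm V) (hV : TransProp V) :
    Shifting V := by
  intro A hA β θ γ h p q p' q' hp hq hpq hpq' hγ
  have := shifting_aux hT hV hA (β := β) (θ := θ) (γ := γ ⊓ θ) (le_inf h inf_le_right)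
    inf_le_right hp hq hpq (Congruence.inf_rel.2 ⟨hγ, hpq'⟩)
  exact (Congruence.inf_rel.1 this).1

/-! ### The Shifting Lemma implies modularity -/

/-- Auxiliary property of a compatible reflexive relation. -/
structure NRel (α δ : Congruence A) (Φ : A.carrier → A.carrier → Prop) : Prop where
  compat : ∀ (f : σ.ops) (a b : Fin (σ.arity f) → A.carrier),
      (∀ i, Φ (a i) (b i)) → Φ (A.interp f a) (A.interp f b)
  refl : ∀ a, Φ a a
  sub : ∀ a b, α.rel a b → Φ a b → δ.rel a b

theorem NRel.step {V : Variety σ} (hS : Shifting V) (hA : V.Mem A) {α δ : Congruence A}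
    {Φ : A.carrier → A.carrier → Prop} (h : NRel α δ Φ) :
    NRel α δ (fun a b => ∃ r, Φ a r ∧ Φ b r) where
  compat := by
    intro f a b hab
    choose r h1 h2 using hab
    exact ⟨_, h.compat f _ _ h1, h.compat f _ _ h2⟩
  refl a := ⟨a, h.refl a, h.refl a⟩
  sub := by
    rintro p q hpq ⟨r, hpr, hqr⟩
    let E := relAlg A Φ h.compat
    let f1 := relFst A Φ h.compat
    let f2 := relSnd A Φ h.compat
    let α1 : Congruence E := comapCong f1 α
    let α2 : Congruence E := comapCong f2 α
    let bot : Congruence A := ⟨Eq, ⟨fun _ => rfl, Eq.symm, Eq.trans⟩,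
      fun f a b h => congrArg (A.interp f) (funext h)⟩
    let n1 : Congruence E := comapCong f1 bot
    let n2 : Congruence E := comapCong f2 bot
    have key := hS E (relAlg_mem hA Φ h.compat) n1 (α1 ⊓ α2) ((n1 ⊓ α2) ⊔ (n2 ⊓ α1))
      ((le_inf inf_le_left (inf_le_right.trans inf_le_right)).trans le_sup_left)
      ⟨(p, p), h.refl p⟩ ⟨(q, q), h.refl q⟩ ⟨(p, r), hpr⟩ ⟨(q, r), hqr⟩
      rfl rfl (Congruence.inf_rel.2 ⟨hpq, hpq⟩)
      (Congruence.inf_rel.2 ⟨hpq, α.iseqv.refl r⟩)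
      (Congruence.sup_right _ (Congruence.inf_rel.2 ⟨rfl, hpq⟩))
    have key2 := Congruence.sup_induction (A := E)
      (P := fun X Y => (α.rel X.1.1 X.1.2 ↔ α.rel Y.1.1 Y.1.2) ∧
        (α.rel X.1.1 X.1.2 → δ.rel X.1.1 Y.1.1)) ?_ ?_ ?_ key
    · exact key2.2 (α.iseqv.refl _)
    · refine ⟨fun X => ⟨Iff.rfl, fun _ => δ.iseqv.refl _⟩, ?_, ?_⟩
      · intro X Y h
        exact ⟨h.1.symm, fun g => δ.iseqv.symm (h.2 (h.1.2 g))⟩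
      · intro X Y Z h k
        exact ⟨h.1.trans k.1, fun g => δ.iseqv.trans (h.2 g) (k.2 (h.1.1 g))⟩
    · intro X Y hXY
      obtain ⟨k1, k2⟩ := Congruence.inf_rel.1 hXY
      change X.1.1 = Y.1.1 at k1
      change α.rel X.1.2 Y.1.2 at k2
      rw [k1]
      exact ⟨⟨fun g => α.iseqv.trans g k2, fun g => α.iseqv.trans g (α.iseqv.symm k2)⟩,
        fun _ => δ.iseqv.refl _⟩
    · intro X Y hXY
      obtain ⟨k1, k2⟩ := Congruence.inf_rel.1 hXY
      change X.1.2 = Y.1.2 at k1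
      change α.rel X.1.1 Y.1.1 at k2
      have g1 : α.rel X.1.1 X.1.2 → α.rel Y.1.1 Y.1.2 := fun g => by
        rw [← k1]; exact α.iseqv.trans (α.iseqv.symm k2) g
      have g2 : α.rel Y.1.1 Y.1.2 → α.rel X.1.1 X.1.2 := fun g => by
        rw [k1]; exact α.iseqv.trans k2 g
      refine ⟨⟨g1, g2⟩, fun g => ?_⟩
      have d1 := h.sub _ _ g X.2
      have d2 := h.sub _ _ (g1 g) Y.2
      rw [k1] at d1
      exact δ.iseqv.trans d1 (δ.iseqv.symm d2)

/-- The iterated relations. -/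
def iterRel (β γ : Congruence A) : ℕ → A.carrier → A.carrier → Prop
  | 0 => fun a b => ∃ r, β.rel a r ∧ γ.rel r b
  | n + 1 => fun a b => ∃ r, iterRel β γ n a r ∧ iterRel β γ n b r

theorem iterRel_refl (β γ : Congruence A) (n : ℕ) : ∀ a, iterRel β γ n a a := by
  induction n with
  | zero => exact fun a => ⟨a, β.iseqv.refl a, γ.iseqv.refl a⟩
  | succ n ih => exact fun a => ⟨a, ih a, ih a⟩

theorem iterRel_mono (β γ : Congruence A) {m n : ℕ} (h : m ≤ n) {a b : A.carrier}
    (hab : iterRel β γ m a b) : iterRel β γ n a b := by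
  induction n, h using Nat.le_induction with
  | base => exact hab
  | succ n _ ih => exact ⟨b, ih, iterRel_refl β γ n b⟩

theorem iterRel_symm (β γ : Congruence A) {n : ℕ} {a b : A.carrier}
    (hab : iterRel β γ n a b) : iterRel β γ (n + 1) b a :=
  ⟨b, iterRel_refl β γ n b, hab⟩

theorem iterRel_equiv (β γ : Congruence A) :
    Equivalence (fun a b => ∃ n, iterRel β γ n a b) := by
  refine ⟨fun a => ⟨0, iterRel_refl β γ 0 a⟩, ?_, ?_⟩
  · rintro a b ⟨n, h⟩
    exact ⟨n + 1, iterRel_symm β γ h⟩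
  · rintro a b c ⟨n, h⟩ ⟨m, k⟩
    have h' := iterRel_mono β γ (Nat.le_max_left n (m + 1)) h
    have k' := iterRel_mono β γ (Nat.le_max_right n (m + 1)) (iterRel_symm β γ k)
    exact ⟨max n (m + 1) + 1, b, h', k'⟩

theorem modular_of_shifting {V : Variety σ} (hS : Shifting V) : CongruenceModular V := by
  intro A hA
  refine ⟨?_⟩
  intro γ β α hγ p q hpq
  obtain ⟨h1, h2⟩ := Congruence.inf_rel.1 hpq
  have hN : ∀ n, NRel α (γ ⊔ β ⊓ α) (iterRel β γ n) := by
    intro n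
    induction n with
    | zero =>
      refine ⟨?_, iterRel_refl β γ 0, ?_⟩
      · intro f a b hab
        choose r k1 k2 using hab
        exact ⟨_, β.compat f _ _ k1, γ.compat f _ _ k2⟩
      · rintro a b hab ⟨r, k1, k2⟩
        have k3 : α.rel a r := α.iseqv.trans hab (α.iseqv.symm (hγ _ _ k2))
        exact Congruence.iseqv _ |>.trans
          (Congruence.sup_right _ (Congruence.inf_rel.2 ⟨k1, k3⟩)) (Congruence.sup_left _ k2)
    | succ n ih => exact ih.step hS hA
  obtain ⟨n, hn⟩ := Congruence.sup_induction (iterRel_equiv β γ)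
    (fun a b h => ⟨0, a, β.iseqv.refl a, h⟩) (fun a b h => ⟨0, b, h, γ.iseqv.refl b⟩) h1
  exact (hN n).sub p q h2 hn

theorem shifting_of_modular {V : Variety σ} (hM : CongruenceModular V) : Shifting V := by
  intro A hA β θ γ h p q p' q' hp hq hpq hpq' hγ
  haveI := hM A hA
  have h1 : ((γ ⊓ θ) ⊔ β).rel p q :=
    Congruence.iseqv _ |>.trans (Congruence.sup_right _ hp)
      (Congruence.iseqv _ |>.trans
        (Congruence.sup_left _ (Congruence.inf_rel.2 ⟨hγ, hpq'⟩))
        (Congruence.sup_right _ (β.iseqv.symm hq)))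
  have h2 : ((γ ⊓ θ) ⊔ β) ⊓ θ ≤ (γ ⊓ θ) ⊔ β ⊓ θ :=
    IsModularLattice.sup_inf_le_assoc_of_le β inf_le_right
  exact (h2.trans (sup_le inf_le_left h)) p q (Congruence.inf_rel.2 ⟨h1, hpq⟩)

/-! ### Centralizers via `Δ` -/

/-- The `S,T`-matrices, as an inductively generated relation on pairs. -/
inductive Mat (S T : Congruence A) : (algOn A T).carrier → (algOn A T).carrier → Prop
  | row (a b : A.carrier) (h : S.rel a b) :
      Mat S T ⟨(a, a), T.iseqv.refl a⟩ ⟨(b, b), T.iseqv.refl b⟩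
  | col (P : (algOn A T).carrier) : Mat S T P P
  | op (f : σ.ops) (P Q : Fin (σ.arity f) → (algOn A T).carrier)
      (h : ∀ i, Mat S T (P i) (Q i)) :
      Mat S T ((algOn A T).interp f P) ((algOn A T).interp f Q)

theorem Mat.exists_term {S T : Congruence A} {P Q : (algOn A T).carrier} (h : Mat S T P Q) :
    ∃ (m n : ℕ) (t : Trm σ (Sum (Fin m) (Fin n))) (a b : Fin m → A.carrier)
      (u v : Fin n → A.carrier), (∀ i, S.rel (a i) (b i)) ∧ (∀ j, T.rel (u j) (v j)) ∧
      P.1.1 = A.evalTrm (Sum.elim a u) t ∧ P.1.2 = A.evalTrm (Sum.elim a v) t ∧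
      Q.1.1 = A.evalTrm (Sum.elim b u) t ∧ Q.1.2 = A.evalTrm (Sum.elim b v) t := by
  induction h with
  | row a b h =>
    exact ⟨1, 0, .var (Sum.inl 0), fun _ => a, fun _ => b, Fin.elim0, Fin.elim0,
      fun _ => h, fun j => j.elim0, rfl, rfl, rfl, rfl⟩
  | col P =>
    exact ⟨0, 1, .var (Sum.inr 0), Fin.elim0, Fin.elim0, fun _ => P.1.1, fun _ => P.1.2,
      fun j => j.elim0, fun _ => P.2, rfl, rfl, rfl, rfl⟩
  | op f P Q _ ih =>
    choose m n t a b u v hS hT h1 h2 h3 h4 using ih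
    have ev : ∀ (x : ∀ i, Fin (m i) → A.carrier) (y : ∀ i, Fin (n i) → A.carrier),
        A.evalTrm (Sum.elim (fun k => x (finSigmaFinEquiv.symm k).1 (finSigmaFinEquiv.symm k).2)
          (fun k => y (finSigmaFinEquiv.symm k).1 (finSigmaFinEquiv.symm k).2))
          (.op f fun i => (t i).ren
            (Sum.map (fun k => finSigmaFinEquiv ⟨i, k⟩) (fun k => finSigmaFinEquiv ⟨i, k⟩)))
        = A.interp f (fun i => A.evalTrm (Sum.elim (x i) (y i)) (t i)) := by
      intro x y
      simp only [Alg.evalTrm, eval_ren]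
      congr 1
      funext i
      congr 1
      funext z
      have aux : ∀ (k : Fin (σ.arity f) → ℕ) (w : ∀ i, Fin (k i) → A.carrier) (s s' : Σ i, Fin (k i)),
          s = s' → w s.1 s.2 = w s'.1 s'.2 := by
        rintro _ _ _ _ rfl
        rfl
      rcases z with z | z
      · exact aux m x _ ⟨i, z⟩ (Equiv.symm_apply_apply _ _)
      · exact aux n y _ ⟨i, z⟩ (Equiv.symm_apply_apply _ _)
    refine ⟨_, _, _, _, _, _, _, ?_, ?_,
      Eq.trans ?_ (ev a u).symm, Eq.trans ?_ (ev a v).symm,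
      Eq.trans ?_ (ev b u).symm, Eq.trans ?_ (ev b v).symm⟩
    · intro k; exact hS _ _
    · intro k; exact hT _ _
    · exact congrArg (A.interp f) (funext h1)
    · exact congrArg (A.interp f) (funext h2)
    · exact congrArg (A.interp f) (funext h3)
    · exact congrArg (A.interp f) (funext h4)

theorem Mat.symm {S T : Congruence A} {P Q : (algOn A T).carrier} (h : Mat S T P Q) :
    Mat S T Q P := by
  induction h with
  | row a b h => exact .row b a (S.iseqv.symm h)
  | col P => exact .col P
  | op f P Q _ ih => exact .op f Q P ih

/-- The congruence generated by matrices. -/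
def matCong (S T : Congruence A) : Congruence (algOn A T) :=
  genCong (algOn A T) (Mat S T) (by
    intro f a i x y hxy
    apply Mat.op
    intro j
    by_cases hj : j = i
    · subst hj; simpa using hxy
    · simpa [hj] using Mat.col _)

theorem diagDelta_rel {α β : Congruence A} {x z : A.carrier} (h : β.rel x z) :
    (diagDelta A α β).rel ((diagHom A α).toFun x) ((diagHom A α).toFun z) :=
  fun _ hc => hc x z h

theorem cent_sat {S T δ : Congruence A} (hc : Centralizes S T δ) {P Q : (algOn A T).carrier}
    (h : (diagDelta A T S).rel P Q) : δ.rel P.1.1 P.1.2 ↔ δ.rel Q.1.1 Q.1.2 := by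
  have h1 : (matCong S T).rel P Q := h (matCong S T) (fun x z hxz => .rel _ _ (.row x z hxz))
  have hM : ∀ P Q, Mat S T P Q → δ.rel P.1.1 P.1.2 → δ.rel Q.1.1 Q.1.2 := by
    intro P Q hPQ hP
    obtain ⟨m, n, t, a, b, u, v, hS, hT, e1, e2, e3, e4⟩ := hPQ.exists_term
    rw [e1, e2] at hP
    rw [e3, e4]
    exact hc m n t a b u v hS hT hP
  exact eqvGen_le (P := fun P Q : (algOn A T).carrier =>
      δ.rel P.1.1 P.1.2 ↔ δ.rel Q.1.1 Q.1.2)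
    ⟨fun _ => Iff.rfl, Iff.symm, Iff.trans⟩
    (fun P Q hPQ => ⟨hM P Q hPQ, hM Q P hPQ.symm⟩) h1

/-- A matrix, as a pair of elements of `A(T)`, is in `Δ`. -/
theorem matrix_delta {S T : Congruence A} (D : Congruence (algOn A T))
    (hD : ∀ x z, S.rel x z → D.rel ((diagHom A T).toFun x) ((diagHom A T).toFun z))
    {m n : ℕ} (t : Trm σ (Sum (Fin m) (Fin n)))
    {a b : Fin m → A.carrier} {u v : Fin n → A.carrier}
    (hab : ∀ i, S.rel (a i) (b i)) (huv : ∀ j, T.rel (u j) (v j)) :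
    D.rel ⟨(A.evalTrm (Sum.elim a u) t, A.evalTrm (Sum.elim a v) t),
        T.eval_sum (fun _ => T.iseqv.refl _) huv t⟩
      ⟨(A.evalTrm (Sum.elim b u) t, A.evalTrm (Sum.elim b v) t),
        T.eval_sum (fun _ => T.iseqv.refl _) huv t⟩ := by
  let w : Fin n → (algOn A T).carrier := fun j => ⟨(u j, v j), huv j⟩
  have key : ∀ c : Fin m → A.carrier,
      (⟨(A.evalTrm (Sum.elim c u) t, A.evalTrm (Sum.elim c v) t),
        T.eval_sum (fun _ => T.iseqv.refl _) huv t⟩ : (algOn A T).carrier)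
      = (algOn A T).evalTrm (Sum.elim (fun i => (diagHom A T).toFun (c i)) w) t := by
    intro c
    apply Subtype.ext
    apply Prod.ext
    · exact ((pr1 A T).eval_sum (fun i => (diagHom A T).toFun (c i)) w t).symm
    · exact ((pr2 A T).eval_sum (fun i => (diagHom A T).toFun (c i)) w t).symm
  rw [key a, key b]
  exact D.eval_sum (fun i => hD _ _ (hab i)) (fun _ => D.iseqv.refl _) t

theorem cent_sup {S S' T δ : Congruence A} (h : Centralizes S T δ) (h' : Centralizes S' T δ) :
    Centralizes (S ⊔ S') T δ := by
  intro m n t a b u v hab huv hd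
  have h1 := matrix_delta (S := S ⊔ S') (diagDelta A T S ⊔ diagDelta A T S') (by
    intro x z hxz
    refine Congruence.sup_induction (P := fun x z => (diagDelta A T S ⊔ diagDelta A T S').rel
      ((diagHom A T).toFun x) ((diagHom A T).toFun z)) ?_ ?_ ?_ hxz
    · exact (comapCong (diagHom A T) (diagDelta A T S ⊔ diagDelta A T S')).iseqv
    · intro x z k; exact Congruence.sup_left _ (diagDelta_rel k)
    · intro x z k; exact Congruence.sup_right _ (diagDelta_rel k)) t hab huv
  have h2 := Congruence.sup_induction (P := fun P Q : (algOn A T).carrier =>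
      δ.rel P.1.1 P.1.2 ↔ δ.rel Q.1.1 Q.1.2)
    ⟨fun _ => Iff.rfl, Iff.symm, Iff.trans⟩ (fun P Q k => cent_sat h k)
    (fun P Q k => cent_sat h' k) h1
  exact h2.1 hd

/-! ### Commutator theory in modular varieties -/

theorem cent_eta {V : Variety σ} (hS : Shifting V) (hA : V.Mem A) {α β δ : Congruence A}
    (hc : Centralizes α β δ) : eta1 A β ⊓ diagDelta A β α ≤ on2 β δ := by
  intro X Y hXY
  obtain ⟨h1, h2⟩ := Congruence.inf_rel.1 hXY
  change X.1.1 = Y.1.1 at h1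
  change δ.rel X.1.2 Y.1.2
  have hbc : β.rel X.1.2 Y.1.2 := by
    refine β.iseqv.trans (β.iseqv.symm X.2) ?_
    rw [h1]
    exact Y.2
  let P : (algOn A β).carrier := ⟨(X.1.2, X.1.2), β.iseqv.refl _⟩
  let Q : (algOn A β).carrier := ⟨(X.1.2, Y.1.2), hbc⟩
  have h3 : (diagDelta A β α).rel P Q := by
    refine hS _ (algOn_mem hA β) (eta2 A β) (eta1 A β) (diagDelta A β α) ?_ P Q X Y
      rfl rfl rfl h1 h2
    intro Z W hZW
    obtain ⟨k1, k2⟩ := Congruence.inf_rel.1 hZW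
    have : Z = W := Subtype.ext (Prod.ext k2 k1)
    rw [this]
    exact Congruence.iseqv _ |>.refl _
  exact (cent_sat hc h3).1 (δ.iseqv.refl _)

theorem cent_swap_aux {V : Variety σ} (hS : Shifting V) (hA : V.Mem A) {α β δ : Congruence A}
    (he : eta1 A β ⊓ diagDelta A β α ≤ on2 β δ) : Centralizes β α δ := by
  intro m n t a b u v hab huv hd
  -- pass to the transposed matrix
  let t' : Trm σ (Sum (Fin n) (Fin m)) := t.ren Sum.swap
  have ev : ∀ (x : Fin m → A.carrier) (y : Fin n → A.carrier),
      A.evalTrm (Sum.elim y x) t' = A.evalTrm (Sum.elim x y) t := by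
    intro x y
    rw [eval_ren]
    congr 1
    funext z
    cases z <;> rfl
  have h1 := matrix_delta (S := α) (T := β) (diagDelta A β α) (fun x z k => diagDelta_rel k)
    t' huv hab
  have h2 : α.rel (A.evalTrm (Sum.elim u a) t') (A.evalTrm (Sum.elim v a) t') :=
    α.eval_sum huv (fun _ => α.iseqv.refl _) t'
  have h3 := hS _ (algOn_mem hA β) (eta1 A β) (diagDelta A β α) (on2 β δ) he
    ⟨(A.evalTrm (Sum.elim u a) t', A.evalTrm (Sum.elim u b) t'),
      β.eval_sum (fun _ => β.iseqv.refl _) hab t'⟩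
    ⟨(A.evalTrm (Sum.elim v a) t', A.evalTrm (Sum.elim v b) t'),
      β.eval_sum (fun _ => β.iseqv.refl _) hab t'⟩
    ((diagHom A β).toFun (A.evalTrm (Sum.elim u a) t'))
    ((diagHom A β).toFun (A.evalTrm (Sum.elim v a) t'))
    rfl rfl h1 (diagDelta_rel h2) (by
      change δ.rel (A.evalTrm (Sum.elim u a) t') (A.evalTrm (Sum.elim v a) t')
      rw [ev, ev]
      exact hd)
  change δ.rel (A.evalTrm (Sum.elim u b) t') (A.evalTrm (Sum.elim v b) t') at h3
  rwa [ev, ev] at h3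

theorem cent_swap {V : Variety σ} (hS : Shifting V) (hA : V.Mem A) {α β δ : Congruence A}
    (hc : Centralizes α β δ) : Centralizes β α δ :=
  cent_swap_aux hS hA (cent_eta hS hA hc)

theorem cent_up {V : Variety σ} (hS : Shifting V) (hA : V.Mem A) {α β δ ε : Congruence A}
    (hc : Centralizes α β δ) (h : δ ≤ ε) : Centralizes α β ε :=
  cent_swap hS hA (cent_swap_aux hS hA
    ((cent_eta hS hA hc).trans (fun _ _ k => h _ _ k)))

theorem left_of_shifting {V : Variety σ} (hS : Shifting V) : CommLeftDistrib V := by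
  intro A hA x y z
  apply le_antisymm
  · apply commC_le
    exact cent_sup (cent_up hS hA (cent_commC x z) le_sup_left)
      (cent_up hS hA (cent_commC y z) le_sup_right)
  · exact sup_le (commC_le (cent_mono le_sup_left le_rfl (cent_commC _ _)))
      (commC_le (cent_mono le_sup_right le_rfl (cent_commC _ _)))

theorem right_of_shifting {V : Variety σ} (hS : Shifting V) : CommRightDistrib V := by
  intro A hA x y z
  apply le_antisymm
  · apply commC_le
    apply cent_swap hS hA
    exact cent_sup (cent_swap hS hA (cent_up hS hA (cent_commC x y) le_sup_left))
      (cent_swap hS hA (cent_up hS hA (cent_commC x z) le_sup_right))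
  · exact sup_le (commC_le (cent_mono le_rfl le_sup_left (cent_commC _ _)))
      (commC_le (cent_mono le_rfl le_sup_right (cent_commC _ _)))

end Helpers

/-- If a variety `V` has a Taylor term, then `V` is congruence modular iff the
commutator is left distributive in `V` iff the commutator is right
distributive in `V`. -/
theorem modular_iff_distributive {σ : Sig} (V : Variety σ)
    (hT : HasTaylorTrm V) :
    List.TFAE [CongruenceModular V, CommLeftDistrib V, CommRightDistrib V] := by
  tfae_have 1 → 2 := fun h => left_of_shifting (shifting_of_modular h)
  tfae_have 1 → 3 := fun h => right_of_shifting (shifting_of_modular h)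
  tfae_have 2 → 1 := fun h => modular_of_shifting (shifting_of_trans hT (transProp_of_left h))
  tfae_have 3 → 1 := fun h => modular_of_shifting (shifting_of_trans hT (transProp_of_right h))
  tfae_finish
end

section
/- If a variety V has a Taylor term, then the following are equivalent: (1) V has a difference term; (2) right annihilators exist throughout V, i.e., for every A ∈ V and every congruence x on A there exists a largest congruence y with [x,y] = 0; (3) the commutator is right semidistributive throughout V, i.e., for all congruences x, y, y' on any algebra in V, [x,y] = [x,y'] implies [x,y] = [x, y + y']. -/
namespace DT

/-- Substitution of terms for variables. -/
def subst {σ : Sig} {V W : Type} (s : V → Trm σ W) : Trm σ V → Trm σ W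
  | .var v => s v
  | .op f ts => .op f (fun i => subst s (ts i))

theorem eval_subst {σ : Sig} (A : Alg σ) {V W : Type} (s : V → Trm σ W)
    (asg : W → A.carrier) (t : Trm σ V) :
    A.evalTrm asg (subst s t) = A.evalTrm (fun v => A.evalTrm asg (s v)) t := by
  induction t with
  | var v => rfl
  | op f ts ih =>
    simp only [subst, Alg.evalTrm]
    congr 1
    funext i
    exact ih i

theorem hom_eval {σ : Sig} {A B : Alg σ} (h : UAHom A B) {V : Type} (asg : V → A.carrier)
    (t : Trm σ V) :
    h.toFun (A.evalTrm asg t) = B.evalTrm (fun v => h.toFun (asg v)) t := by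
  induction t with
  | var v => rfl
  | op f ts ih =>
    simp only [Alg.evalTrm, h.map_op]
    congr 1
    funext i
    exact ih i

theorem cong_eval {σ : Sig} {A : Alg σ} (c : Congruence A) {V : Type} (a b : V → A.carrier)
    (h : ∀ v, c.rel (a v) (b v)) (t : Trm σ V) : c.rel (A.evalTrm a t) (A.evalTrm b t) := by
  induction t with
  | var v => exact h v
  | op f ts ih => exact c.compat f _ _ ih

theorem vec3_comp {X Y : Type} (φ : X → Y) (a b c : X) :
    (fun v => φ ((![a, b, c] : Fin 3 → X) v)) = ![φ a, φ b, φ c] := by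
  funext v; fin_cases v <;> rfl

theorem vec2_comp {X Y : Type} (φ : X → Y) (a b : X) :
    (fun v => φ ((![a, b] : Fin 2 → X) v)) = ![φ a, φ b] := by
  funext v; fin_cases v <;> rfl

theorem eval_subst3 {σ : Sig} (A : Alg σ) {W : Type} (s0 s1 s2 : Trm σ W)
    (asg : W → A.carrier) (t : Trm σ (Fin 3)) :
    A.evalTrm asg (subst ![s0, s1, s2] t)
      = A.evalTrm ![A.evalTrm asg s0, A.evalTrm asg s1, A.evalTrm asg s2] t := by
  rw [eval_subst, vec3_comp]

theorem eval_subst2 {σ : Sig} (A : Alg σ) {W : Type} (s0 s1 : Trm σ W)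
    (asg : W → A.carrier) (t : Trm σ (Fin 2)) :
    A.evalTrm asg (subst ![s0, s1] t)
      = A.evalTrm ![A.evalTrm asg s0, A.evalTrm asg s1] t := by
  rw [eval_subst, vec2_comp]

theorem hom_eval3 {σ : Sig} {A B : Alg σ} (h : UAHom A B) (a b c : A.carrier)
    (t : Trm σ (Fin 3)) :
    h.toFun (A.evalTrm ![a, b, c] t) = B.evalTrm ![h.toFun a, h.toFun b, h.toFun c] t := by
  rw [hom_eval, vec3_comp]

theorem cong_eval3 {σ : Sig} {A : Alg σ} (r : Congruence A) {a b c a' b' c' : A.carrier}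
    (ha : r.rel a a') (hb : r.rel b b') (hc : r.rel c c') (t : Trm σ (Fin 3)) :
    r.rel (A.evalTrm ![a, b, c] t) (A.evalTrm ![a', b', c'] t) := by
  apply cong_eval
  intro v
  fin_cases v
  · exact ha
  · exact hb
  · exact hc

/-- The `S,T`-matrices, generated inductively. -/
inductive Mtx {σ : Sig} {A : Alg σ} (S T : Congruence A) :
    A.carrier → A.carrier → A.carrier → A.carrier → Prop
  | row {a b : A.carrier} : S.rel a b → Mtx S T a a b b
  | col {u v : A.carrier} : T.rel u v → Mtx S T u v u v
  | op (f : σ.ops) (p q r s : Fin (σ.arity f) → A.carrier) :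
      (∀ i, Mtx S T (p i) (q i) (r i) (s i)) →
      Mtx S T (A.interp f p) (A.interp f q) (A.interp f r) (A.interp f s)

namespace Mtx

variable {σ : Sig} {A : Alg σ} {S T : Congruence A} {p q r s : A.carrier}

theorem rfl' (a : A.carrier) : Mtx S T a a a a := .row (S.iseqv.refl a)

theorem left (h : Mtx S T p q r s) : S.rel p r := by
  induction h with
  | row h => exact h
  | col h => exact S.iseqv.refl _
  | op f p q r s _ ih => exact S.compat f _ _ ih

theorem right (h : Mtx S T p q r s) : S.rel q s := by
  induction h with
  | row h => exact h
  | col h => exact S.iseqv.refl _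
  | op f p q r s _ ih => exact S.compat f _ _ ih

theorem top (h : Mtx S T p q r s) : T.rel p q := by
  induction h with
  | row h => exact T.iseqv.refl _
  | col h => exact h
  | op f p q r s _ ih => exact T.compat f _ _ ih

theorem bot (h : Mtx S T p q r s) : T.rel r s := by
  induction h with
  | row h => exact T.iseqv.refl _
  | col h => exact h
  | op f p q r s _ ih => exact T.compat f _ _ ih

theorem flipRow (h : Mtx S T p q r s) : Mtx S T r s p q := by
  induction h with
  | row h => exact .row (S.iseqv.symm h)
  | col h => exact .col h
  | op f p q r s _ ih => exact .op f _ _ _ _ ih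

theorem flipCol (h : Mtx S T p q r s) : Mtx S T q p s r := by
  induction h with
  | row h => exact .row h
  | col h => exact .col (T.iseqv.symm h)
  | op f p q r s _ ih => exact .op f _ _ _ _ ih

theorem transp (h : Mtx S T p q r s) : Mtx T S p r q s := by
  induction h with
  | row h => exact .col h
  | col h => exact .row h
  | op f p q r s _ ih => exact .op f _ _ _ _ ih

theorem eval {I : Type} (t : Trm σ I) (p q r s : I → A.carrier)
    (h : ∀ i, Mtx S T (p i) (q i) (r i) (s i)) :
    Mtx S T (A.evalTrm p t) (A.evalTrm q t) (A.evalTrm r t) (A.evalTrm s t) := by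
  induction t with
  | var v => exact h v
  | op f ts ih => exact .op f _ _ _ _ ih

theorem eval3 (t : Trm σ (Fin 3)) {p q r s p' q' r' s' p'' q'' r'' s'' : A.carrier}
    (h : Mtx S T p q r s) (h' : Mtx S T p' q' r' s') (h'' : Mtx S T p'' q'' r'' s'') :
    Mtx S T (A.evalTrm ![p, p', p''] t) (A.evalTrm ![q, q', q''] t)
      (A.evalTrm ![r, r', r''] t) (A.evalTrm ![s, s', s''] t) := by
  apply eval
  intro i
  fin_cases i
  · exact h
  · exact h'
  · exact h''

theorem map {B : Alg σ} (h : UAHom A B) {S' T' : Congruence B}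
    (hS : ∀ a b, S.rel a b → S'.rel (h.toFun a) (h.toFun b))
    (hT : ∀ a b, T.rel a b → T'.rel (h.toFun a) (h.toFun b))
    (hm : Mtx S T p q r s) :
    Mtx S' T' (h.toFun p) (h.toFun q) (h.toFun r) (h.toFun s) := by
  induction hm with
  | row h => exact .row (hS _ _ h)
  | col h => exact .col (hT _ _ h)
  | op f p q r s _ ih => simp only [h.map_op]; exact .op f _ _ _ _ ih

theorem mono {S' T' : Congruence A} (hS : S ≤ S') (hT : T ≤ T') (hm : Mtx S T p q r s) :
    Mtx S' T' p q r s := by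
  induction hm with
  | row h => exact .row (hS _ _ h)
  | col h => exact .col (hT _ _ h)
  | op f p q r s _ ih => exact .op f _ _ _ _ ih

theorem toTerm (h : Mtx S T p q r s) :
    ∃ (m n : ℕ) (t : Trm σ (Sum (Fin m) (Fin n)))
      (a b : Fin m → A.carrier) (u v : Fin n → A.carrier),
      (∀ i, S.rel (a i) (b i)) ∧ (∀ j, T.rel (u j) (v j)) ∧
      A.evalTrm (Sum.elim a u) t = p ∧ A.evalTrm (Sum.elim a v) t = q ∧
      A.evalTrm (Sum.elim b u) t = r ∧ A.evalTrm (Sum.elim b v) t = s := by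
  induction h with
  | @row a b h =>
    exact ⟨1, 0, .var (.inl 0), fun _ => a, fun _ => b, Fin.elim0, Fin.elim0, fun _ => h,
      fun j => j.elim0, rfl, rfl, rfl, rfl⟩
  | @col u v h =>
    exact ⟨0, 1, .var (.inr 0), Fin.elim0, Fin.elim0, fun _ => u, fun _ => v,
      fun j => j.elim0, fun _ => h, rfl, rfl, rfl, rfl⟩
  | op f p q r s _ ih =>
    choose m n t a b u v hab huv hp hq hr hs using ih
    let e : (Σ i, Fin (m i)) ≃ Fin (Fintype.card (Σ i, Fin (m i))) := Fintype.equivFin _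
    let e' : (Σ i, Fin (n i)) ≃ Fin (Fintype.card (Σ i, Fin (n i))) := Fintype.equivFin _
    have key : ∀ (a : ∀ i, Fin (m i) → A.carrier) (u : ∀ i, Fin (n i) → A.carrier) (i),
        A.evalTrm (Sum.elim (fun k => a (e.symm k).1 (e.symm k).2)
            (fun k => u (e'.symm k).1 (e'.symm k).2))
          (subst (Sum.elim (fun k => .var (.inl (e ⟨i, k⟩)))
            (fun k => .var (.inr (e' ⟨i, k⟩)))) (t i))
        = A.evalTrm (Sum.elim (a i) (u i)) (t i) := by
      intro a u i
      rw [eval_subst]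
      congr 1
      funext k
      cases k with
      | inl k =>
        show a (e.symm (e ⟨i, k⟩)).1 (e.symm (e ⟨i, k⟩)).2 = a i k
        rw [e.symm_apply_apply]
      | inr k =>
        show u (e'.symm (e' ⟨i, k⟩)).1 (e'.symm (e' ⟨i, k⟩)).2 = u i k
        rw [e'.symm_apply_apply]
    refine ⟨_, _, .op f (fun i => subst (Sum.elim (fun k => .var (.inl (e ⟨i, k⟩)))
            (fun k => .var (.inr (e' ⟨i, k⟩)))) (t i)),
      fun k => a (e.symm k).1 (e.symm k).2, fun k => b (e.symm k).1 (e.symm k).2,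
      fun k => u (e'.symm k).1 (e'.symm k).2, fun k => v (e'.symm k).1 (e'.symm k).2,
      fun k => hab _ _, fun k => huv _ _, ?_, ?_, ?_, ?_⟩
    · simp only [Alg.evalTrm, key, hp]
    · simp only [Alg.evalTrm, key, hq]
    · simp only [Alg.evalTrm, key, hr]
    · simp only [Alg.evalTrm, key, hs]

end Mtx

/-- The centralizer relation in terms of inductively generated matrices. -/
def Cz {σ : Sig} {A : Alg σ} (S T δ : Congruence A) : Prop :=
  ∀ p q r s, Mtx S T p q r s → δ.rel p q → δ.rel r s

theorem centralizes_iff {σ : Sig} {A : Alg σ} (S T δ : Congruence A) :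
    Centralizes S T δ ↔ Cz S T δ := by
  constructor
  · intro h p q r s hm hpq
    obtain ⟨m, n, t, a, b, u, v, hab, huv, rfl, rfl, rfl, rfl⟩ := hm.toTerm
    exact h m n t a b u v hab huv hpq
  · intro h m n t a b u v hab huv
    apply h
    apply Mtx.eval
    rintro (i | j)
    · exact .row (hab i)
    · exact .col (huv j)

theorem bot_rel {σ : Sig} {A : Alg σ} {a b : A.carrier} :
    (⊥ : Congruence A).rel a b ↔ a = b := by
  constructor
  · intro h
    let e : Congruence A := ⟨Eq, ⟨fun _ => rfl, Eq.symm, Eq.trans⟩,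
      fun f a b h => by rw [funext h]⟩
    exact (bot_le : (⊥ : Congruence A) ≤ e) a b h
  · rintro rfl
    exact (⊥ : Congruence A).iseqv.refl _

theorem cz_comm {σ : Sig} {A : Alg σ} (S T : Congruence A) : Cz S T (commC S T) := by
  intro p q r s hm hpq δ hδ
  exact (centralizes_iff _ _ _).1 hδ p q r s hm (hpq δ hδ)

theorem comm_le {σ : Sig} {A : Alg σ} {S T δ : Congruence A} (h : Cz S T δ) :
    commC S T ≤ δ := fun _ _ hab => hab δ ((centralizes_iff _ _ _).2 h)

theorem comm_eq_bot {σ : Sig} {A : Alg σ} {S T : Congruence A} :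
    commC S T = ⊥ ↔ Cz S T ⊥ := by
  constructor
  · intro h
    have := cz_comm S T
    rwa [h] at this
  · intro h
    exact le_bot_iff.1 (comm_le h)

theorem comm_le_left {σ : Sig} {A : Alg σ} (S T : Congruence A) : commC S T ≤ S :=
  comm_le fun _ _ _ _ hm hpq =>
    S.iseqv.trans (S.iseqv.symm hm.left) (S.iseqv.trans hpq hm.right)

theorem comm_le_right {σ : Sig} {A : Alg σ} (S T : Congruence A) : commC S T ≤ T :=
  comm_le fun _ _ _ _ hm _ => hm.bot

theorem cz_mono {σ : Sig} {A : Alg σ} {S T S' T' δ : Congruence A} (h : Cz S' T' δ)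
    (hS : S ≤ S') (hT : T ≤ T') : Cz S T δ :=
  fun p q r s hm => h p q r s (hm.mono hS hT)

/-- Changing coordinates one at a time. -/
theorem one_at {n : ℕ} {X B : Type} (r : B → B → Prop) (hr : ∀ a, r a a)
    (ht : ∀ a b c, r a b → r b c → r a c) (φ : (Fin n → X) → B) (a b : Fin n → X)
    (h : ∀ i c, (∀ j, c j = a j ∨ c j = b j) → c i = a i →
      r (φ c) (φ (Function.update c i (b i)))) : r (φ a) (φ b) := by
  have key : ∀ s : Finset (Fin n), r (φ a) (φ (s.piecewise b a)) := by
    intro s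
    induction s using Finset.induction_on with
    | empty => simpa using hr _
    | insert j s hj ih =>
      rw [Finset.piecewise_insert]
      refine ht _ _ _ ih (h j _ ?_ ?_)
      · intro k
        by_cases hk : k ∈ s <;> simp [hk]
      · simp [hj]
  simpa using key Finset.univ

/-- A congruence from an equivalence relation compatible in each single argument. -/
def ofUnary {σ : Sig} {A : Alg σ} (r : A.carrier → A.carrier → Prop) (he : Equivalence r)
    (h : ∀ (f : σ.ops) (a : Fin (σ.arity f) → A.carrier) (i : Fin (σ.arity f)) (b : A.carrier),
      r (a i) b → r (A.interp f a) (A.interp f (Function.update a i b))) : Congruence A where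
  rel := r
  iseqv := he
  compat f a b hab := by
    refine one_at r he.refl (fun _ _ _ => he.trans) (A.interp f) a b ?_
    intro i c _ hci
    exact h f c i _ (hci ▸ hab i)

/-- Telescoping over the arguments of a term. -/
theorem tele {σ : Sig} {A : Alg σ} {θ ζ : Congruence A} (hC : Cz θ θ ζ) {n : ℕ}
    (T : Trm σ (Fin n)) (a b : Fin n → A.carrier) (hab : ∀ i, θ.rel (a i) (b i))
    (h : ∀ i, ∃ c : Fin n → A.carrier, (∀ j, θ.rel (c j) (a j)) ∧
      ζ.rel (A.evalTrm (Function.update c i (a i)) T)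
        (A.evalTrm (Function.update c i (b i)) T)) :
    ζ.rel (A.evalTrm a T) (A.evalTrm b T) := by
  refine one_at ζ.rel ζ.iseqv.refl (fun _ _ _ => ζ.iseqv.trans)
    (fun a => A.evalTrm a T) a b ?_
  intro i c' hc' hi
  obtain ⟨c, hc, hz⟩ := h i
  refine hC _ _ _ _ ?_ hz
  apply Mtx.eval
  intro j
  by_cases hj : j = i
  · subst hj
    simp only [Function.update_self, hi]
    exact .col (hab _)
  · simp only [Function.update_of_ne hj]
    apply Mtx.row
    rcases hc' j with h' | h' <;> rw [h']
    · exact hc j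
    · exact θ.iseqv.trans (hc j) (hab j)

/-! ### Quotients -/

theorem mk_out_rel {σ : Sig} {A : Alg σ} (c : Congruence A) (a : A.carrier) :
    c.rel (Quotient.mk c.setoid a).out a :=
  Quotient.exact (s := c.setoid) (Quotient.out_eq _)

/-- The quotient homomorphism. -/
noncomputable def mkHom {σ : Sig} (A : Alg σ) (c : Congruence A) : UAHom A (quotAlg A c) where
  toFun a := Quotient.mk c.setoid a
  map_op f a := Quotient.sound (s := c.setoid)
    (c.compat f _ _ fun i => c.iseqv.symm (mk_out_rel c (a i)))

theorem mkHom_surj {σ : Sig} (A : Alg σ) (c : Congruence A) :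
    Function.Surjective (mkHom A c).toFun := fun q => ⟨q.out, Quotient.out_eq q⟩

theorem mkHom_eq {σ : Sig} {A : Alg σ} {c : Congruence A} {a b : A.carrier} :
    (mkHom A c).toFun a = (mkHom A c).toFun b ↔ c.rel a b :=
  ⟨fun h => Quotient.exact (s := c.setoid) h, fun h => Quotient.sound (s := c.setoid) h⟩

theorem mem_quot {σ : Sig} (V : Variety σ) {A : Alg σ} (hA : V.Mem A) (c : Congruence A) :
    V.Mem (quotAlg A c) := V.closed_hom hA ⟨mkHom A c, mkHom_surj A c⟩

/-- The congruence `x/δ` on `A/δ`. -/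
noncomputable def quotCong {σ : Sig} {A : Alg σ} (δ x : Congruence A) (h : δ ≤ x) :
    Congruence (quotAlg A δ) where
  rel P Q := x.rel (Quotient.out P) (Quotient.out Q)
  iseqv := ⟨fun _ => x.iseqv.refl _, x.iseqv.symm, x.iseqv.trans⟩
  compat f a b hab := by
    refine x.iseqv.trans (h _ _ (mk_out_rel δ _)) (x.iseqv.trans ?_
      (x.iseqv.symm (h _ _ (mk_out_rel δ _))))
    exact x.compat f _ _ hab

theorem quotCong_mk {σ : Sig} {A : Alg σ} {δ x : Congruence A} (h : δ ≤ x) {a b : A.carrier} :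
    (quotCong δ x h).rel ((mkHom A δ).toFun a) ((mkHom A δ).toFun b) ↔ x.rel a b := by
  have h1 := h _ _ (mk_out_rel δ a)
  have h2 := h _ _ (mk_out_rel δ b)
  exact ⟨fun h' => x.iseqv.trans (x.iseqv.symm h1) (x.iseqv.trans h' h2),
    fun h' => x.iseqv.trans h1 (x.iseqv.trans h' (x.iseqv.symm h2))⟩

theorem mtx_lift {σ : Sig} {A : Alg σ} {δ S T : Congruence A} (hS : δ ≤ S) (hT : δ ≤ T)
    {p q r s : (quotAlg A δ).carrier}
    (h : Mtx (quotCong δ S hS) (quotCong δ T hT) p q r s) :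
    ∃ p' q' r' s', (mkHom A δ).toFun p' = p ∧ (mkHom A δ).toFun q' = q ∧
      (mkHom A δ).toFun r' = r ∧ (mkHom A δ).toFun s' = s ∧ Mtx S T p' q' r' s' := by
  induction h with
  | @row a b h =>
    exact ⟨_, _, _, _, Quotient.out_eq a, Quotient.out_eq a, Quotient.out_eq b,
      Quotient.out_eq b, .row h⟩
  | @col a b h =>
    exact ⟨_, _, _, _, Quotient.out_eq a, Quotient.out_eq b, Quotient.out_eq a,
      Quotient.out_eq b, .col h⟩
  | op f p q r s _ ih =>
    choose p' q' r' s' hp hq hr hs hm using ih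
    refine ⟨_, _, _, _, ?_, ?_, ?_, ?_, .op f p' q' r' s' hm⟩
    · simp only [(mkHom A δ).map_op, hp]
    · simp only [(mkHom A δ).map_op, hq]
    · simp only [(mkHom A δ).map_op, hr]
    · simp only [(mkHom A δ).map_op, hs]

theorem cz_quot {σ : Sig} {A : Alg σ} {δ S T : Congruence A} (hS : δ ≤ S) (hT : δ ≤ T)
    (h : Cz S T δ) : Cz (quotCong δ S hS) (quotCong δ T hT) ⊥ := by
  intro p q r s hm hpq
  obtain ⟨p', q', r', s', rfl, rfl, rfl, rfl, hm'⟩ := mtx_lift hS hT hm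
  rw [bot_rel, mkHom_eq] at hpq ⊢
  exact h _ _ _ _ hm' hpq

/-- Pullback of a congruence along a homomorphism. -/
def comap {σ : Sig} {A B : Alg σ} (h : UAHom A B) (c : Congruence B) : Congruence A where
  rel a b := c.rel (h.toFun a) (h.toFun b)
  iseqv := ⟨fun _ => c.iseqv.refl _, c.iseqv.symm, c.iseqv.trans⟩
  compat f a b hab := by
    rw [h.map_op, h.map_op]
    exact c.compat f _ _ hab

theorem cz_comap {σ : Sig} {A B : Alg σ} (h : UAHom A B) {S T δ : Congruence B}
    (hC : Cz S T δ) : Cz (comap h S) (comap h T) (comap h δ) :=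
  fun _ _ _ _ hm hpq => hC _ _ _ _ (hm.map h (fun _ _ x => x) (fun _ _ x => x)) hpq

/-- Existence of right annihilators throughout `V`. -/
def RA {σ : Sig} (V : Variety σ) : Prop :=
  ∀ A : Alg σ, V.Mem A → ∀ x : Congruence A,
        ∃ y : Congruence A, commC x y = ⊥ ∧
          ∀ y' : Congruence A, commC x y' = ⊥ → y' ≤ y

theorem RA.rel {σ : Sig} {V : Variety σ} (h : RA V) {A : Alg σ} (hA : V.Mem A)
    {x y y' δ : Congruence A} (hx : δ ≤ x) (hy : δ ≤ y) (hy' : δ ≤ y')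
    (h1 : Cz x y δ) (h2 : Cz x y' δ) : Cz x (y ⊔ y') δ := by
  obtain ⟨z, hz, hmax⟩ := h _ (mem_quot V hA δ) (quotCong δ x hx)
  have e1 := hmax _ (comm_eq_bot.2 (cz_quot hx hy h1))
  have e2 := hmax _ (comm_eq_bot.2 (cz_quot hx hy' h2))
  have l1 : y ≤ comap (mkHom A δ) z := fun a b hab => e1 _ _ ((quotCong_mk hy).2 hab)
  have l2 : y' ≤ comap (mkHom A δ) z := fun a b hab => e2 _ _ ((quotCong_mk hy').2 hab)
  have hc := cz_comap (mkHom A δ) (comm_eq_bot.1 hz)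
  intro p q r s hm hpq
  have := hc p q r s (hm.mono (fun a b hab => (quotCong_mk hx).2 hab) (sup_le l1 l2))
    (bot_rel.2 (mkHom_eq.2 hpq))
  exact mkHom_eq.1 (bot_rel.1 this)

/-! ### (3) implies (2) -/

theorem fin_join {σ : Sig} {A : Alg σ} (P : Congruence A → Prop) (h0 : P ⊥)
    (h1 : ∀ y y', P y → P y' → P (y ⊔ y')) {n : ℕ} (ys : Fin n → Congruence A)
    (h : ∀ i, P (ys i)) : ∃ y, P y ∧ ∀ i, ys i ≤ y :=
  ⟨Finset.univ.sup ys, Finset.sup_induction h0 (fun a ha b hb => h1 a b ha hb) (fun i _ => h i),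
    fun i => Finset.le_sup (Finset.mem_univ i)⟩

theorem three_two {σ : Sig} (V : Variety σ)
    (h : ∀ A : Alg σ, V.Mem A → ∀ x y y' : Congruence A,
        commC x y = commC x y' → commC x y = commC x (y ⊔ y')) : RA V := by
  intro A hA x
  have h0 : commC x ⊥ = ⊥ := le_bot_iff.1 (comm_le_right x ⊥)
  have h1 : ∀ y y', commC x y = ⊥ → commC x y' = ⊥ → commC x (y ⊔ y') = ⊥ := by
    intro y y' hy hy'
    rw [← h A hA x y y' (hy.trans hy'.symm), hy]
  let Y : Congruence A :=
    { rel := fun a b => ∃ y : Congruence A, commC x y = ⊥ ∧ y.rel a b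
      iseqv := ⟨fun a => ⟨⊥, h0, bot_rel.2 rfl⟩,
        fun ⟨y, hy, hab⟩ => ⟨y, hy, y.iseqv.symm hab⟩,
        fun ⟨y, hy, hab⟩ ⟨y', hy', hbc⟩ => ⟨y ⊔ y', h1 _ _ hy hy',
          (y ⊔ y').iseqv.trans ((le_sup_left : y ≤ y ⊔ y') _ _ hab)
            ((le_sup_right : y' ≤ y ⊔ y') _ _ hbc)⟩⟩
      compat := fun f a b hab => by
        choose ys hys hab using hab
        obtain ⟨y, hy, hle⟩ := fin_join (fun y => commC x y = ⊥) h0 h1 ys hys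
        exact ⟨y, hy, y.compat f a b fun i => hle i _ _ (hab i)⟩ }
  have hm : ∀ p q r s, Mtx x Y p q r s → ∃ y, commC x y = ⊥ ∧ Mtx x y p q r s := by
    intro p q r s hm
    induction hm with
    | row h => exact ⟨⊥, h0, .row h⟩
    | col h => obtain ⟨y, hy, h⟩ := h; exact ⟨y, hy, .col h⟩
    | op f p q r s _ ih =>
      choose ys hys hm using ih
      obtain ⟨y, hy, hle⟩ := fin_join (fun y => commC x y = ⊥) h0 h1 ys hys
      exact ⟨y, hy, .op f _ _ _ _ fun i => (hm i).mono le_rfl (hle i)⟩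
  refine ⟨Y, comm_eq_bot.2 ?_, fun y' hy' a b hab => ⟨y', hy', hab⟩⟩
  intro p q r s h hpq
  obtain ⟨y, hy, h'⟩ := hm p q r s h
  exact comm_eq_bot.1 hy p q r s h' hpq

/-! ### (1) implies (3) -/

/-- Matrices generated by one pair of rows and by constant `T`-columns. -/
inductive M2 {σ : Sig} {A : Alg σ} (T : Congruence A) (p0 q0 r0 s0 : A.carrier) :
    A.carrier → A.carrier → A.carrier → A.carrier → Prop
  | hole : M2 T p0 q0 r0 s0 p0 q0 r0 s0
  | col {u v : A.carrier} : T.rel u v → M2 T p0 q0 r0 s0 u v u v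
  | op (f : σ.ops) (p q r s : Fin (σ.arity f) → A.carrier) :
      (∀ i, M2 T p0 q0 r0 s0 (p i) (q i) (r i) (s i)) →
      M2 T p0 q0 r0 s0 (A.interp f p) (A.interp f q) (A.interp f r) (A.interp f s)

theorem M2.same {σ : Sig} {A : Alg σ} {T : Congruence A} {a b p q r s : A.carrier}
    (h : M2 T a b a b p q r s) : p = r ∧ q = s := by
  induction h with
  | hole => exact ⟨rfl, rfl⟩
  | col h => exact ⟨rfl, rfl⟩
  | op f p q r s _ ih =>
    exact ⟨congrArg _ (funext fun i => (ih i).1), congrArg _ (funext fun i => (ih i).2)⟩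

theorem M2.flip {σ : Sig} {A : Alg σ} {T : Congruence A} {a b c d p q r s : A.carrier}
    (h : M2 T a b c d p q r s) : M2 T c d a b r s p q := by
  induction h with
  | hole => exact .hole
  | col h => exact .col h
  | op f p q r s _ ih => exact .op f _ _ _ _ ih

theorem M2.mid {σ : Sig} {A : Alg σ} {T : Congruence A} {a b e e' p q r s : A.carrier}
    (c d : A.carrier) (h : M2 T a b e e' p q r s) :
    ∃ p' q', M2 T a b c d p q p' q' ∧ M2 T c d e e' p' q' r s := by
  induction h with
  | hole => exact ⟨c, d, .hole, .hole⟩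
  | col h => exact ⟨_, _, .col h, .col h⟩
  | op f p q r s _ ih =>
    choose p' q' h1 h2 using ih
    exact ⟨_, _, .op f _ _ _ _ h1, .op f _ _ _ _ h2⟩

/-- The largest congruence on `A(T)` saturating `δ`. -/
def syn {σ : Sig} {A : Alg σ} (T δ : Congruence A) : Congruence (algOn A T) :=
  ofUnary (fun P Q => ∀ p q r s, M2 T P.1.1 P.1.2 Q.1.1 Q.1.2 p q r s → (δ.rel p q ↔ δ.rel r s))
    ⟨fun P p q r s h => by obtain ⟨rfl, rfl⟩ := h.same; rfl,
     fun h p q r s hm => (h _ _ _ _ hm.flip).symm,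
     fun {P Q R} h1 h2 p q r s hm => by
      obtain ⟨p', q', a, b⟩ := hm.mid Q.1.1 Q.1.2
      exact (h1 _ _ _ _ a).trans (h2 _ _ _ _ b)⟩
    (by
      intro f P i Q h p q r s hm
      apply h
      induction hm with
      | hole =>
        apply M2.op
        intro j
        by_cases hj : j = i
        · subst hj
          simp only [Function.update_self]
          exact .hole
        · simp only [Function.update_of_ne hj]
          exact .col (P j).2
      | col h => exact .col h
      | op f p q r s _ ih => exact .op f _ _ _ _ ih)

/-- The largest congruence `S` with `C(S,T;δ)`. -/
def leftAnn {σ : Sig} {A : Alg σ} (T δ : Congruence A) : Congruence A where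
  rel a b := (syn T δ).rel ⟨(a, a), T.iseqv.refl a⟩ ⟨(b, b), T.iseqv.refl b⟩
  iseqv := ⟨fun _ => (syn T δ).iseqv.refl _, (syn T δ).iseqv.symm, (syn T δ).iseqv.trans⟩
  compat f a b h := (syn T δ).compat f _ _ h

theorem le_leftAnn {σ : Sig} {A : Alg σ} {S T δ : Congruence A} :
    Cz S T δ ↔ S ≤ leftAnn T δ := by
  constructor
  · intro h a b hab p q r s hm
    have : Mtx S T p q r s := by
      induction hm with
      | hole => exact .row hab
      | col h => exact .col h
      | op f p q r s _ ih => exact .op f _ _ _ _ ih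
    exact ⟨h _ _ _ _ this, h _ _ _ _ this.flipRow⟩
  · intro h p q r s hm hpq
    have : (syn T δ).rel ⟨(p, q), hm.top⟩ ⟨(r, s), hm.bot⟩ := by
      clear hpq
      induction hm with
      | row hab => exact h _ _ hab
      | col _ => exact (syn T δ).iseqv.refl _
      | op f p q r s hm ih =>
        exact (syn T δ).compat f (fun i => ⟨(p i, q i), (hm i).top⟩)
          (fun i => ⟨(r i, s i), (hm i).bot⟩) ih
    exact (this _ _ _ _ .hole).1 hpq

theorem cz_sup_left {σ : Sig} {A : Alg σ} {S S' T δ : Congruence A} (h : Cz S T δ)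
    (h' : Cz S' T δ) : Cz (S ⊔ S') T δ :=
  le_leftAnn.2 (sup_le (le_leftAnn.1 h) (le_leftAnn.1 h'))

theorem diff_rel {σ : Sig} {V : Variety σ} {d : Trm σ (Fin 3)} (hd : IsDifferenceTrm V d)
    {A : Alg σ} (hA : V.Mem A) {γ δ : Congruence A} (hle : δ ≤ γ) (hC : Cz γ γ δ)
    {a b : A.carrier} (hab : γ.rel a b) : δ.rel (A.evalTrm ![a, b, b] d) a := by
  have := hd.2 _ (mem_quot V hA δ) (quotCong δ γ hle)
    (comm_eq_bot.2 (cz_quot hle hle hC)) ((mkHom A δ).toFun a) ((mkHom A δ).toFun b)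
    ((quotCong_mk hle).2 hab)
  rw [← hom_eval3] at this
  exact mkHom_eq.1 this

theorem cz_symm {σ : Sig} {V : Variety σ} {d : Trm σ (Fin 3)} (hd : IsDifferenceTrm V d)
    {A : Alg σ} (hA : V.Mem A) {x y δ : Congruence A} (hx : δ ≤ x) (hy : δ ≤ y)
    (hC : Cz x y δ) : Cz y x δ := by
  intro p r q s hm hpr
  have hm' := hm.transp
  have hle : δ ≤ x ⊓ y := le_inf hx hy
  have hC' : Cz (x ⊓ y) (x ⊓ y) δ := cz_mono hC inf_le_left inf_le_right
  have hqx : x.rel q s := hm'.right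
  have hqy : y.rel q s := y.iseqv.trans (y.iseqv.symm hm'.top)
    (y.iseqv.trans (hy _ _ hpr) hm'.bot)
  have hqs : (x ⊓ y).rel q s := by
    intro c hc
    rcases hc with rfl | rfl
    · exact hqx
    · exact hqy
  have h1 := diff_rel hd hA hle hC' hqs
  have m : Mtx x y (A.evalTrm ![r, r, s] d) (A.evalTrm ![s, s, s] d)
      (A.evalTrm ![p, r, s] d) (A.evalTrm ![q, s, s] d) := by
    apply Mtx.eval3
    · exact hm'.flipRow
    · exact .col hm'.bot
    · exact .rfl' s
  have h2 := hC _ _ _ _ m (by rw [hd.1 A hA, hd.1 A hA]; exact δ.iseqv.refl _)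
  have h3 : δ.rel (A.evalTrm ![p, r, s] d) s := by
    have := cong_eval3 δ hpr (δ.iseqv.refl r) (δ.iseqv.refl s) d
    rwa [hd.1 A hA] at this
  exact δ.iseqv.trans (δ.iseqv.symm h1) (δ.iseqv.trans (δ.iseqv.symm h2) h3)

theorem one_three {σ : Sig} (V : Variety σ) (h : ∃ d : Trm σ (Fin 3), IsDifferenceTrm V d) :
    ∀ A : Alg σ, V.Mem A → ∀ x y y' : Congruence A,
        commC x y = commC x y' → commC x y = commC x (y ⊔ y') := by
  obtain ⟨d, hd⟩ := h
  intro A hA x y y' he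
  apply le_antisymm
  · exact comm_le (cz_mono (cz_comm x (y ⊔ y')) le_rfl le_sup_left)
  · apply comm_le
    have hx := comm_le_left x y
    have hy := comm_le_right x y
    have hy' : commC x y ≤ y' := he ▸ comm_le_right x y'
    have c1 := cz_symm hd hA hx hy (cz_comm x y)
    have c2 := cz_symm hd hA hx hy' (he ▸ cz_comm x y')
    exact cz_symm hd hA (hy.trans le_sup_left) hx (cz_sup_left c1 c2)

/-! ### The two-generated free algebra -/

/-- The algebra of binary terms. -/
def Tm (σ : Sig) : Alg σ := ⟨Trm σ (Fin 2), Trm.op⟩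

theorem tm_eval {σ : Sig} (t : Trm σ (Fin 2)) : (Tm σ).evalTrm (fun v => Trm.var v) t = t := by
  induction t with
  | var v => rfl
  | op f ts ih =>
    show Trm.op f _ = _
    congr 1
    funext i
    exact ih i

/-- Identities of the variety in two variables. -/
def eqV {σ : Sig} (V : Variety σ) : Congruence (Tm σ) where
  rel s t := ∀ A : Alg σ, V.Mem A → ∀ asg : Fin 2 → A.carrier,
    A.evalTrm asg (show Trm σ (Fin 2) from s) = A.evalTrm asg (show Trm σ (Fin 2) from t)
  iseqv := ⟨fun _ _ _ _ => rfl, fun h A hA asg => (h A hA asg).symm,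
    fun h h' A hA asg => (h A hA asg).trans (h' A hA asg)⟩
  compat f a b h A hA asg := congrArg (A.interp f) (funext fun i => h i A hA asg)

/-- The homomorphism from the free algebra given by an assignment. -/
noncomputable def frHom {σ : Sig} (V : Variety σ) (A : Alg σ) (hA : V.Mem A)
    (asg : Fin 2 → A.carrier) : UAHom (quotAlg (Tm σ) (eqV V)) A where
  toFun q := A.evalTrm asg (show Trm σ (Fin 2) from Quotient.out q)
  map_op f a := mk_out_rel (eqV V) _ A hA asg

theorem frHom_mk {σ : Sig} (V : Variety σ) (A : Alg σ) (hA : V.Mem A)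
    (asg : Fin 2 → A.carrier) (t : Trm σ (Fin 2)) :
    (frHom V A hA asg).toFun ((mkHom (Tm σ) (eqV V)).toFun t) = A.evalTrm asg t :=
  mk_out_rel (eqV V) _ A hA asg

/-- A free algebra of the variety on two generators. -/
structure Fr {σ : Sig} (V : Variety σ) where
  F : Alg σ
  x : F.carrier
  y : F.carrier
  mem : V.Mem F
  gen : ∀ e, ∃ s : Trm σ (Fin 2), F.evalTrm ![x, y] s = e
  univ : ∀ A, V.Mem A → ∀ a b, ∃ h : UAHom F A, h.toFun x = a ∧ h.toFun y = b

theorem exists_fr {σ : Sig} (V : Variety σ) : Nonempty (Fr V) := by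
  classical
  let F := quotAlg (Tm σ) (eqV V)
  let m := mkHom (Tm σ) (eqV V)
  have hmem : V.Mem F := by
    have hI : ∀ i : {st : Trm σ (Fin 2) × Trm σ (Fin 2) // ¬ (eqV V).rel st.1 st.2},
        ∃ A : Alg σ, ∃ asg : Fin 2 → A.carrier, V.Mem A ∧
          A.evalTrm asg i.1.1 ≠ A.evalTrm asg i.1.2 := by
      intro i
      by_contra hcon
      push Not at hcon
      exact i.2 fun A hA asg => hcon A asg hA
    choose A asg hA hne using hI
    refine V.closed_sub (V.closed_prod A hA) ⟨⟨fun q i => (frHom V (A i) (hA i) (asg i)).toFun q,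
      fun f a => funext fun i => (frHom V (A i) (hA i) (asg i)).map_op f a⟩, ?_⟩
    intro P Q hPQ
    by_contra hne'
    have hn : ¬ (eqV V).rel (Quotient.out P) (Quotient.out Q) := by
      intro h
      apply hne'
      rw [← Quotient.out_eq P, ← Quotient.out_eq Q]
      exact Quotient.sound h
    exact hne ⟨(Quotient.out P, Quotient.out Q), hn⟩ (congrFun hPQ ⟨(_, _), hn⟩)
  refine ⟨⟨F, m.toFun (Trm.var 0), m.toFun (Trm.var 1), hmem, ?_, ?_⟩⟩
  · intro e
    obtain ⟨t, rfl⟩ := mkHom_surj _ _ e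
    refine ⟨t, ?_⟩
    have e1 := hom_eval m (fun v => (Trm.var v : Trm σ (Fin 2))) t
    have e2 : (fun v : Fin 2 => m.toFun (Trm.var v : Trm σ (Fin 2)))
        = ![m.toFun (Trm.var 0 : Trm σ (Fin 2)), m.toFun (Trm.var 1 : Trm σ (Fin 2))] := by
      funext v; fin_cases v <;> rfl
    have e3 := congrArg m.toFun (tm_eval (σ := σ) t)
    exact ((congrArg (fun a => F.evalTrm a t) e2).symm.trans e1.symm).trans e3
  · intro A hA a b
    exact ⟨frHom V A hA ![a, b], frHom_mk V A hA _ _, frHom_mk V A hA _ _⟩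

/-! ### Taylor terms and chains of matrices -/

/-- Normalized Taylor identities on a single algebra. -/
def Tay {σ : Sig} (A : Alg σ) {n : ℕ} (T : Trm σ (Fin n)) : Prop :=
  (∀ c : A.carrier, A.evalTrm (fun _ => c) T = c) ∧
  ∀ i, ∃ w z : Fin n → Bool, w i = true ∧ z i = false ∧ ∀ a b : A.carrier,
    A.evalTrm (fun j => cond (w j) a b) T = A.evalTrm (fun j => cond (z j) a b) T

theorem tay_of {σ : Sig} {V : Variety σ} {n : ℕ} {T : Trm σ (Fin n)} (h : IsTaylorTrm V T)
    {A : Alg σ} (hA : V.Mem A) : Tay A T := by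
  refine ⟨h.2.1 A hA, fun i => ?_⟩
  obtain ⟨w, z, hne, h⟩ := h.2.2 i
  cases hw : w i
  · cases hz : z i
    · simp [hw, hz] at hne
    · exact ⟨z, w, hz, hw, fun a b => (h A hA a b).symm⟩
  · cases hz : z i
    · exact ⟨w, z, hw, hz, h A hA⟩
    · simp [hw, hz] at hne

/-- Horizontally composable sequences of matrices. -/
inductive Chain {σ : Sig} {A : Alg σ} (θ : Congruence A) :
    ℕ → A.carrier → A.carrier → A.carrier → A.carrier → Prop
  | nil (p q : A.carrier) : Chain θ 0 p q p q
  | cons {k : ℕ} {p q p' q' r s : A.carrier} :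
      Mtx θ θ p p' q q' → Chain θ k p' q' r s → Chain θ (k + 1) p q r s

theorem Chain.map {σ : Sig} {A : Alg σ} {θ : Congruence A} (φ ψ : A.carrier → A.carrier)
    (h : ∀ p p' q q', Mtx θ θ p p' q q' → Mtx θ θ (φ p) (φ p') (ψ q) (ψ q'))
    {k : ℕ} {p q r s : A.carrier} (hc : Chain θ k p q r s) :
    Chain θ k (φ p) (ψ q) (φ r) (ψ s) := by
  induction hc with
  | nil p q => exact .nil _ _
  | cons m _ ih => exact .cons (h _ _ _ _ m) ih

theorem Chain.swap {σ : Sig} {A : Alg σ} {θ : Congruence A}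
    {k : ℕ} {p q r s : A.carrier} (hc : Chain θ k p q r s) : Chain θ k q p s r := by
  induction hc with
  | nil p q => exact .nil _ _
  | cons m _ ih => exact .cons m.flipRow ih

theorem Chain.snd {σ : Sig} {A : Alg σ} {θ : Congruence A}
    {k : ℕ} {p q r s : A.carrier} (hc : Chain θ k p q r s) : θ.rel q s := by
  induction hc with
  | nil p q => exact θ.iseqv.refl _
  | cons m _ ih => exact θ.iseqv.trans m.bot ih

theorem chain_cz {σ : Sig} {A : Alg σ} {θ ζ : Congruence A} (hC : Cz θ θ ζ) {n : ℕ}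
    {T : Trm σ (Fin n)} (hT : Tay A T) (k : ℕ) : ∀ {p q r s : A.carrier},
    Chain θ k p q r s → ζ.rel p r → ζ.rel q s := by
  induction k with
  | zero =>
    intro p q r s hc _
    cases hc
    exact ζ.iseqv.refl _
  | succ k ih =>
    intro p q r s hc hz
    cases k with
    | zero =>
      cases hc with
      | cons m hc =>
        cases hc
        exact hC _ _ _ _ m hz
    | succ k =>
      have hqs := hc.snd
      cases hc with
      | @cons _ _ _ p1 q1 _ _ m1 hc =>
      cases hc with
      | @cons _ _ _ p2 q2 _ _ m2 hc =>
      have key : ζ.rel (A.evalTrm (fun _ => q) T) (A.evalTrm (fun _ => s) T) := by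
        refine tele hC T _ _ (fun _ => hqs) ?_
        intro i
        obtain ⟨w, z, hw, hz', hwz⟩ := hT.2 i
        refine ⟨fun j => cond (z j) q1 q2, ?_, ?_⟩
        · intro j
          show θ.rel (cond (z j) q1 q2) q
          cases z j
          · exact θ.iseqv.symm (θ.iseqv.trans m1.bot m2.bot)
          · exact θ.iseqv.symm m1.bot
        · refine ih (p := A.evalTrm (Function.update (fun j => cond (z j) p1 p2) i p) T)
            (r := A.evalTrm (Function.update (fun j => cond (z j) p1 p2) i r) T) ?_ ?_
          · have e : ∀ a b : A.carrier, A.evalTrm (fun j => cond (w j) a b) T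
                = A.evalTrm (Function.update (fun j => cond (z j) a b) i b) T := by
              intro a b
              rw [hwz]
              congr 1
              funext j
              by_cases hj : j = i
              · subst hj; simp [hz']
              · simp [hj]
            refine .cons (p' := A.evalTrm (Function.update (fun j => cond (z j) p1 p2) i p2) T)
              (q' := A.evalTrm (Function.update (fun j => cond (z j) q1 q2) i q2) T) ?_ ?_
            · rw [← e p1 p2, ← e q1 q2]
              apply Mtx.eval
              intro j
              by_cases hj : j = i
              · subst hj; simpa [hw] using m1
              · simp only [Function.update_of_ne hj]
                cases z j <;> cases w j
                · exact .row m2.right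
                · exact m2.flipCol
                · exact m2
                · exact .row m1.right
            · refine hc.map (fun a => A.evalTrm (Function.update (fun j => cond (z j) p1 p2) i a) T)
                (fun a => A.evalTrm (Function.update (fun j => cond (z j) q1 q2) i a) T) ?_
              intro a a' b b' m
              apply Mtx.eval
              intro j
              by_cases hj : j = i
              · subst hj; simpa using m
              · simp only [Function.update_of_ne hj]
                cases z j
                · exact .row m2.right
                · exact .row m1.right
          · apply cong_eval
            intro j
            by_cases hj : j = i
            · subst hj; simpa using hz
            · simp only [Function.update_of_ne hj]
              exact ζ.iseqv.refl _
      rwa [hT.1, hT.1] at key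


/-! ### The congruence `Z` on the free algebra -/

/-- Terms satisfying the first Maltsev identity. -/
def KK {σ : Sig} (V : Variety σ) (u : Trm σ (Fin 3)) : Prop :=
  ∀ A : Alg σ, V.Mem A → ∀ a b : A.carrier, A.evalTrm ![a, a, b] u = b

namespace Fr

variable {σ : Sig} {V : Variety σ} (P : Fr V)

/-- Evaluation of ternary terms in the free algebra. -/
abbrev ev (t : Trm σ (Fin 3)) (a b c : P.F.carrier) : P.F.carrier := P.F.evalTrm ![a, b, c] t

/-- The congruence generated by the two generators. -/
abbrev th : Congruence P.F := cgPair P.F P.x P.y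

/-- The commutator square of `th`. -/
abbrev ze : Congruence P.F := commC P.th P.th

theorem th_xy : P.th.rel P.x P.y := fun _ hc => hc

theorem th_le {c : Congruence P.F} (h : c.rel P.x P.y) : P.th ≤ c := fun _ _ hab => hab c h

theorem th_hom {A : Alg σ} (h : UAHom P.F A) (hxy : h.toFun P.x = h.toFun P.y)
    {a b : P.F.carrier} (hab : P.th.rel a b) : h.toFun a = h.toFun b := by
  have : P.th ≤ comap h ⊥ := P.th_le (bot_rel.2 hxy)
  exact bot_rel.1 (this _ _ hab)

theorem idem {g : Trm σ (Fin 3)} (hg : P.th.rel (P.ev g P.x P.x P.x) P.x)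
    (A : Alg σ) (hA : V.Mem A) (a : A.carrier) : A.evalTrm ![a, a, a] g = a := by
  obtain ⟨h, hx, hy⟩ := P.univ A hA a a
  have := P.th_hom h (hx.trans hy.symm) hg
  rwa [hom_eval3, hx] at this

/-- The relation `J`. -/
def J (c d : P.F.carrier) : Prop := ∃ u, KK V u ∧ P.ze.rel c (P.ev u P.x P.y d)

theorem J.refl (c : P.F.carrier) : P.J c c :=
  ⟨.var 2, fun _ _ _ _ => rfl, P.ze.iseqv.refl _⟩

variable {P}

theorem J.trans {c d e : P.F.carrier} (h : P.J c d) (h' : P.J d e) : P.J c e := by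
  obtain ⟨u, hu, h⟩ := h
  obtain ⟨v, hv, h'⟩ := h'
  refine ⟨subst ![.var 0, .var 1, v] u, ?_, ?_⟩
  · intro A hA a b
    rw [eval_subst3, hv A hA]
    exact hu A hA a b
  · refine P.ze.iseqv.trans h ?_
    simp only [ev]
    rw [eval_subst3]
    exact cong_eval3 _ (P.ze.iseqv.refl _) (P.ze.iseqv.refl _) h' u

theorem J.symm {n : ℕ} {T : Trm σ (Fin n)} (hT : Tay P.F T) {c d : P.F.carrier} (h : P.J c d) :
    P.J d c := by
  obtain ⟨u, hu, h⟩ := h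
  have ux : ∀ a, P.ev u P.x P.x a = a := fun a => hu _ P.mem _ _
  have uy : ∀ a, P.ev u P.y P.y a = a := fun a => hu _ P.mem _ _
  have hdc : P.th.rel d (P.ev u P.x P.y d) := by
    have := cong_eval3 P.th (P.th.iseqv.refl P.x) P.th_xy (P.th.iseqv.refl d) u
    rwa [hu _ P.mem] at this
  have m1 : Mtx P.th P.th (P.ev u P.y P.x d) d (P.ev u P.y P.x (P.ev u P.x P.y d))
      (P.ev u P.x P.y d) := by
    have := Mtx.eval3 u (.col (P.th.iseqv.symm P.th_xy)) (.rfl' P.x)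
      (Mtx.row hdc : Mtx P.th P.th _ _ _ _)
    rwa [hu _ P.mem P.x d, hu _ P.mem P.x (P.ev u P.x P.y d)] at this
  have m2 : Mtx P.th P.th d (P.ev u P.y P.x d) (P.ev u P.x P.y d) d := by
    have := Mtx.eval3 u (.col P.th_xy) (.row P.th_xy) (.rfl' d : Mtx P.th P.th _ _ _ _)
    rwa [hu _ P.mem P.x d, hu _ P.mem P.y d] at this
  have h2 := chain_cz (cz_comm P.th P.th) hT 2 (.cons m1 (.cons m2 (.nil _ _)))
    (P.ze.iseqv.refl _)
  refine ⟨subst ![.var 1, .var 0, .var 2] u, ?_, ?_⟩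
  · intro A hA a b
    rw [eval_subst3]
    exact hu A hA a b
  · refine P.ze.iseqv.trans (P.ze.iseqv.symm h2) ?_
    simp only [ev]
    rw [eval_subst3]
    exact cong_eval3 _ (P.ze.iseqv.refl _) (P.ze.iseqv.refl _) (P.ze.iseqv.symm h) u

variable (P)

theorem unary (f : σ.ops) (a : Fin (σ.arity f) → P.F.carrier) (i : Fin (σ.arity f)) :
    ∃ t : Trm σ (Fin 3), ∀ c, P.ev t c P.x P.y = P.F.interp f (Function.update a i c) := by
  choose s hs using fun j => P.gen (a j)
  refine ⟨.op f (fun j => if j = i then .var 0 else subst ![.var 1, .var 2] (s j)), fun c => ?_⟩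
  simp only [ev, Alg.evalTrm]
  congr 1
  funext j
  by_cases hj : j = i
  · subst hj; simp [Alg.evalTrm]
  · rw [if_neg hj, Function.update_of_ne hj, eval_subst2]
    exact hs j

theorem ev_comp (g t : Trm σ (Fin 3)) (c : P.F.carrier) :
    P.ev (subst ![t, .var 1, .var 2] g) c P.x P.y = P.ev g (P.ev t c P.x P.y) P.x P.y := by
  simp only [ev]
  rw [eval_subst3]
  rfl

/-- The congruence `Z`. -/
def Z {n : ℕ} {T : Trm σ (Fin n)} (hT : Tay P.F T) : Congruence P.F :=
  ofUnary (fun c d => P.th.rel c d ∧ ∀ g, P.th.rel (P.ev g c P.x P.y) P.x →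
      P.J (P.ev g c P.x P.y) (P.ev g d P.x P.y))
    ⟨fun c => ⟨P.th.iseqv.refl c, fun g _ => J.refl P _⟩,
     fun {c d} h => ⟨P.th.iseqv.symm h.1, fun g hg => J.symm hT (h.2 g
      (P.th.iseqv.trans (cong_eval3 _ h.1 (P.th.iseqv.refl _) (P.th.iseqv.refl _) g) hg))⟩,
     fun {c d e} h h' => ⟨P.th.iseqv.trans h.1 h'.1, fun g hg => J.trans (h.2 g hg) (h'.2 g
      (P.th.iseqv.trans (cong_eval3 _ (P.th.iseqv.symm h.1) (P.th.iseqv.refl _)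
        (P.th.iseqv.refl _) g) hg))⟩⟩
    (by
      intro f a i b h
      obtain ⟨t, ht⟩ := P.unary f a i
      have e : P.F.interp f a = P.ev t (a i) P.x P.y := by rw [ht, Function.update_eq_self]
      rw [e, ← ht b]
      refine ⟨cong_eval3 _ h.1 (P.th.iseqv.refl _) (P.th.iseqv.refl _) t, fun g hg => ?_⟩
      rw [← ev_comp] at hg ⊢
      rw [← ev_comp]
      exact h.2 _ hg)

variable {n : ℕ} {T : Trm σ (Fin n)} (hT : Tay P.F T)

theorem Z_le : P.Z hT ≤ P.th := fun _ _ h => h.1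

variable {P}

theorem Z.toJ {c d : P.F.carrier} (h : (P.Z hT).rel c d) (hc : P.th.rel c P.x) : P.J c d :=
  h.2 (.var 0) hc

theorem Z.ofJ {c d : P.F.carrier} (hc : P.th.rel c P.x) (hd : P.th.rel d P.x) (h : P.J c d) :
    (P.Z hT).rel c d := by
  refine ⟨P.th.iseqv.trans hc (P.th.iseqv.symm hd), fun g hg => ?_⟩
  have t := @P.th.iseqv.trans
  have s := @P.th.iseqv.symm
  have rr := P.th.iseqv.refl
  have gx : P.th.rel (P.ev g P.x P.x P.x) P.x :=
    t (cong_eval3 _ (s hc) (rr _) P.th_xy g) hg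
  have gi := P.idem gx
  have hd' : P.th.rel (P.ev g d P.x P.y) P.x :=
    t (cong_eval3 _ hd (rr _) (s P.th_xy) g) gx
  obtain ⟨u, hu, h⟩ := h
  refine ⟨subst ![u, .var 2, .var 2] g, ?_, ?_⟩
  · intro A hA a b
    rw [eval_subst3, hu A hA]
    exact gi A hA b
  · refine P.ze.iseqv.trans (cong_eval3 _ h (P.ze.iseqv.refl _) (P.ze.iseqv.refl _) g) ?_
    have m : Mtx P.th P.th
        (P.ev g (P.ev u P.x P.y d) P.x P.y)
        (P.ev g (P.ev u P.x P.x d) P.x P.y)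
        (P.ev g (P.ev u P.x P.y (P.ev g d P.x P.y)) (P.ev g d P.x P.y) (P.ev g d P.x P.y))
        (P.ev g (P.ev u P.x P.x (P.ev g d P.x P.y)) (P.ev g d P.x P.y) (P.ev g d P.x P.y)) := by
      apply Mtx.eval3
      · apply Mtx.eval3
        · exact .rfl' _
        · exact .col (s P.th_xy)
        · exact .row (t hd (s hd'))
      · exact .row (s hd')
      · exact .row (t (s P.th_xy) (s hd'))
    have := cz_comm P.th P.th _ _ _ _ m.flipCol.transp (by
      simp only [ev]
      rw [hu _ P.mem, hu _ P.mem, gi _ P.mem]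
      exact P.ze.iseqv.refl _)
    simp only [ev] at this ⊢
    rw [eval_subst3]
    exact this

variable (P)

theorem Z_cz : Cz P.th P.th (P.Z hT) := by
  intro p q r s m hpq
  refine ⟨m.bot, fun g hg => ?_⟩
  have mg : Mtx P.th P.th (P.ev g p P.x P.y) (P.ev g q P.x P.y) (P.ev g r P.x P.y)
      (P.ev g s P.x P.y) := Mtx.eval3 g m (.rfl' _) (.rfl' _)
  obtain ⟨w, hw, h⟩ := hpq.2 g (P.th.iseqv.trans mg.left hg)
  refine ⟨w, hw, ?_⟩
  have m' := Mtx.eval3 w (.rfl' P.x) (.col P.th_xy) mg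
  rw [hw _ P.mem, hw _ P.mem] at m'
  exact cz_comm P.th P.th _ _ _ _ m' h

theorem diff_of_Z (h : (P.Z hT).rel P.x P.y) : ∃ d, IsDifferenceTrm V d := by
  obtain ⟨u, hu, h⟩ := Z.toJ hT h (P.th.iseqv.refl _)
  refine ⟨u, hu, fun A hA α hα a b hab => ?_⟩
  obtain ⟨φ, hx, hy⟩ := P.univ A hA a b
  have hle : P.th ≤ comap φ α := P.th_le (by
    show α.rel (φ.toFun P.x) (φ.toFun P.y)
    rw [hx, hy]; exact hab)
  have hc := cz_mono (cz_comap φ (comm_eq_bot.1 hα)) hle hle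
  have := bot_rel.1 (comm_le hc _ _ h)
  rw [hom_eval3, hx, hy] at this
  exact this.symm

end Fr


/-! ### (2) implies (1) -/

theorem inf_rel {σ : Sig} {A : Alg σ} {x y : Congruence A} {a b : A.carrier} :
    (x ⊓ y).rel a b ↔ x.rel a b ∧ y.rel a b := by
  constructor
  · intro h
    exact ⟨(inf_le_left : x ⊓ y ≤ x) _ _ h, (inf_le_right : x ⊓ y ≤ y) _ _ h⟩
  · intro h c hc
    rcases hc with rfl | rfl
    · exact h.1
    · exact h.2

theorem cz_inf {σ : Sig} {A : Alg σ} (x y : Congruence A) : Cz x y (x ⊓ y) := by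
  intro p q r s m h
  rw [inf_rel] at h ⊢
  exact ⟨x.iseqv.trans (x.iseqv.symm m.left) (x.iseqv.trans h.1 m.right), m.bot⟩

/-- Telescoping over the arguments of an operation preserving matrices. -/
theorem tele_fun {σ : Sig} {A : Alg σ} {θ ζ : Congruence A} (hC : Cz θ θ ζ) {n : ℕ}
    (φ : (Fin n → A.carrier) → A.carrier)
    (hφ : ∀ p q r s : Fin n → A.carrier, (∀ j, Mtx θ θ (p j) (q j) (r j) (s j)) →
      Mtx θ θ (φ p) (φ q) (φ r) (φ s))
    (a b : Fin n → A.carrier) (hab : ∀ i, θ.rel (a i) (b i))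
    (h : ∀ i, ∃ c : Fin n → A.carrier, (∀ j, θ.rel (c j) (a j)) ∧
      ζ.rel (φ (Function.update c i (a i))) (φ (Function.update c i (b i)))) :
    ζ.rel (φ a) (φ b) := by
  refine one_at ζ.rel ζ.iseqv.refl (fun _ _ _ => ζ.iseqv.trans) φ a b ?_
  intro i c' hc' hi
  obtain ⟨c, hc, hz⟩ := h i
  refine hC _ _ _ _ ?_ hz
  apply hφ
  intro j
  by_cases hj : j = i
  · subst hj
    simp only [Function.update_self, hi]
    exact .col (hab _)
  · simp only [Function.update_of_ne hj]
    apply Mtx.row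
    rcases hc' j with h' | h' <;> rw [h']
    · exact hc j
    · exact θ.iseqv.trans (hc j) (hab j)

theorem Chain.append {σ : Sig} {A : Alg σ} {θ : Congruence A} {k l : ℕ}
    {p q r s t u : A.carrier} (h : Chain θ k p q r s) (h' : Chain θ l r s t u) :
    ∃ m, Chain θ m p q t u := by
  induction h with
  | nil p q => exact ⟨_, h'⟩
  | cons m _ ih =>
    obtain ⟨k', hk⟩ := ih h'
    exact ⟨_, .cons m hk⟩

theorem Chain.rev {σ : Sig} {A : Alg σ} {θ : Congruence A} {k : ℕ}
    {p q r s : A.carrier} (h : Chain θ k p q r s) : ∃ m, Chain θ m r s p q := by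
  induction h with
  | nil p q => exact ⟨0, .nil _ _⟩
  | cons m _ ih =>
    obtain ⟨k', hk⟩ := ih
    exact hk.append (.cons m.flipCol (.nil _ _))

namespace Fr

variable {σ : Sig} {V : Variety σ} (P : Fr V)

/-- Triples of `th`-related elements. -/
structure D3 where
  e : P.F.carrier
  c : P.F.carrier
  d : P.F.carrier
  hc : P.th.rel e c
  hd : P.th.rel e d

/-- The algebra of triples of `th`-related elements. -/
def DA : Alg σ where
  carrier := D3 P
  interp f a := ⟨P.F.interp f fun i => (a i).e, P.F.interp f fun i => (a i).c,
    P.F.interp f fun i => (a i).d, P.th.compat f _ _ fun i => (a i).hc,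
    P.th.compat f _ _ fun i => (a i).hd⟩

/-- First projection. -/
def eH : UAHom P.DA P.F := ⟨D3.e, fun _ _ => rfl⟩

/-- Second projection. -/
def cH : UAHom P.DA P.F := ⟨D3.c, fun _ _ => rfl⟩

/-- Third projection. -/
def dH : UAHom P.DA P.F := ⟨D3.d, fun _ _ => rfl⟩

theorem mem_DA : V.Mem P.DA := by
  refine V.closed_sub (V.closed_prod (fun _ : Fin 3 => P.F) fun _ => P.mem)
    ⟨⟨fun a => ![D3.e a, D3.c a, D3.d a], ?_⟩, ?_⟩
  · intro f a
    funext v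
    fin_cases v <;> rfl
  · intro a b h
    have h0 : D3.e a = D3.e b := congrFun h 0
    have h1 : D3.c a = D3.c b := congrFun h 1
    have h2 : D3.d a = D3.d b := congrFun h 2
    cases a; cases b
    simp only at h0 h1 h2
    subst h0 h1 h2
    rfl

theorem upd_hom {A B : Alg σ} (h : UAHom A B) {n : ℕ} (a : Fin n → A.carrier) (i : Fin n)
    (b : A.carrier) : (fun j => h.toFun (Function.update a i b j))
      = Function.update (fun j => h.toFun (a j)) i (h.toFun b) := by
  funext j
  by_cases hj : j = i
  · subst hj; simp
  · simp [hj]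

theorem interp_upd {A B : Alg σ} (h : UAHom A B) (f : σ.ops) (a : Fin (σ.arity f) → A.carrier)
    (i : Fin (σ.arity f)) (b : A.carrier) : h.toFun (A.interp f (Function.update a i b))
      = B.interp f (Function.update (fun j => h.toFun (a j)) i (h.toFun b)) := by
  rw [h.map_op, upd_hom]

/-- The congruence given by chains of matrices on the last two coordinates. -/
def al : Congruence P.DA :=
  ofUnary (fun a b => ∃ k, Chain P.th k (P.cH.toFun a) (P.dH.toFun a) (P.cH.toFun b)
      (P.dH.toFun b))
    ⟨fun a => ⟨0, .nil _ _⟩, fun ⟨_, h⟩ => h.rev, fun ⟨_, h⟩ ⟨_, h'⟩ => h.append h'⟩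
    (by
      rintro f a i b ⟨k, h⟩
      refine ⟨k, ?_⟩
      have h' := h.map
        (fun c => P.F.interp f (Function.update (fun j => P.cH.toFun (a j)) i c))
        (fun c => P.F.interp f (Function.update (fun j => P.dH.toFun (a j)) i c)) (by
          intro p p' q q' m
          apply Mtx.op
          intro j
          by_cases hj : j = i
          · subst hj; simpa using m
          · simp only [Function.update_of_ne hj]
            exact .row (P.th.iseqv.trans (P.th.iseqv.symm (D3.hc (a j))) (D3.hd (a j))))
      simp only [← interp_upd, Function.update_eq_self] at h'
      exact h')

variable {n : ℕ} {T : Trm σ (Fin n)} (hT : Tay P.F T)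

/-- The congruence attached to a projection. -/
def rho (pr : UAHom P.DA P.F) (hpr : ∀ a, P.th.rel (P.eH.toFun a) (pr.toFun a)) :
    Congruence P.DA :=
  ofUnary (fun a b => P.eH.toFun a = P.eH.toFun b ∧ ∀ g, P.ev g (P.eH.toFun a) P.x P.y = P.x →
      (P.Z hT).rel (P.ev g (pr.toFun a) P.x P.y) (P.ev g (pr.toFun b) P.x P.y))
    ⟨fun a => ⟨rfl, fun g _ => (P.Z hT).iseqv.refl _⟩,
     fun h => ⟨h.1.symm, fun g hg => (P.Z hT).iseqv.symm (h.2 g (h.1 ▸ hg))⟩,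
     fun h h' => ⟨h.1.trans h'.1, fun g hg => (P.Z hT).iseqv.trans (h.2 g hg)
      (h'.2 g (h.1 ▸ hg))⟩⟩
    (by
      intro f a i b h
      have e1 : P.DA.interp f a = P.DA.interp f (Function.update a i (a i)) := by
        rw [Function.update_eq_self]
      rw [e1]
      simp only [interp_upd]
      refine ⟨by rw [h.1], fun g hg => ?_⟩
      obtain ⟨t, ht⟩ := P.unary f (fun j => P.eH.toFun (a j)) i
      rw [← ht, ← ev_comp] at hg
      have h2 := h.2 _ hg
      rw [ev_comp, ev_comp, ht, ht] at h2
      refine P.Z_cz hT _ _ _ _ ?_ h2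
      refine Mtx.eval3 g ?_ (.rfl' _) (.rfl' _)
      apply Mtx.op
      intro j
      by_cases hj : j = i
      · subst hj
        simp only [Function.update_self]
        refine .col (P.th.iseqv.trans (P.th.iseqv.symm (hpr _)) ?_)
        rw [h.1]
        exact hpr _
      · simp only [Function.update_of_ne hj]
        exact .row (hpr _))

/-- The congruence attached to the second coordinate. -/
def rc : Congruence P.DA := P.rho hT P.cH D3.hc

/-- The congruence attached to the third coordinate. -/
def rd : Congruence P.DA := P.rho hT P.dH D3.hd

theorem al_rc : P.al ⊓ P.rc hT = P.al ⊓ P.rd hT := by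
  have key : ∀ (g : Trm σ (Fin 3)) (p p' q q' : P.F.carrier), Mtx P.th P.th p p' q q' →
      Mtx P.th P.th (P.ev g p P.x P.y) (P.ev g p' P.x P.y) (P.ev g q P.x P.y)
        (P.ev g q' P.x P.y) := fun g _ _ _ _ m => Mtx.eval3 g m (.rfl' _) (.rfl' _)
  apply le_antisymm
  · intro a b h
    rw [inf_rel] at h ⊢
    refine ⟨h.1, h.2.1, fun g hg => ?_⟩
    obtain ⟨k, hk⟩ := h.1
    exact chain_cz (P.Z_cz hT) hT k (hk.map (fun c => P.ev g c P.x P.y)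
      (fun c => P.ev g c P.x P.y) (key g)) (h.2.2 g hg)
  · intro a b h
    rw [inf_rel] at h ⊢
    refine ⟨h.1, h.2.1, fun g hg => ?_⟩
    obtain ⟨k, hk⟩ := h.1
    exact chain_cz (P.Z_cz hT) hT k (hk.swap.map (fun c => P.ev g c P.x P.y)
      (fun c => P.ev g c P.x P.y) (key g)) (h.2.2 g hg)

theorem ra_cz (h : RA V) : Cz P.al (P.rc hT ⊔ P.rd hT) (P.al ⊓ P.rc hT) :=
  h.rel P.mem_DA inf_le_left inf_le_right (P.al_rc hT ▸ inf_le_right) (cz_inf _ _)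
    (P.al_rc hT ▸ cz_inf _ _)

/-- The diagonal triple of the first generator. -/
def Xh : P.DA.carrier := D3.mk P.x P.x P.x (P.th.iseqv.refl _) (P.th.iseqv.refl _)

/-- The intermediate triple. -/
def Mh : P.DA.carrier := D3.mk P.x P.x P.y (P.th.iseqv.refl _) P.th_xy

/-- The triple `(x,y,y)`. -/
def Yh : P.DA.carrier := D3.mk P.x P.y P.y P.th_xy P.th_xy

/-- The diagonal triple of the second generator. -/
def Zh : P.DA.carrier := D3.mk P.y P.y P.y (P.th.iseqv.refl _) (P.th.iseqv.refl _)

theorem XY_sup : (P.rc hT ⊔ P.rd hT).rel P.Xh P.Yh := by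
  have h1 : (P.rc hT).rel P.Xh P.Mh := ⟨rfl, fun g _ => (P.Z hT).iseqv.refl _⟩
  have h2 : (P.rd hT).rel P.Mh P.Yh := ⟨rfl, fun g _ => (P.Z hT).iseqv.refl _⟩
  exact (P.rc hT ⊔ P.rd hT).iseqv.trans ((le_sup_left : P.rc hT ≤ P.rc hT ⊔ P.rd hT) _ _ h1)
    ((le_sup_right : P.rd hT ≤ P.rc hT ⊔ P.rd hT) _ _ h2)

theorem XZ_al : P.al.rel P.Xh P.Zh := ⟨1, .cons (.col P.th_xy) (.nil _ _)⟩

theorem XY_al : P.al.rel P.Xh P.Yh := ⟨1, .cons (.col P.th_xy) (.nil _ _)⟩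

theorem eval_upd {A B : Alg σ} (h : UAHom A B) {n : ℕ} (T : Trm σ (Fin n)) (c b : A.carrier)
    (i : Fin n) : h.toFun (A.evalTrm (Function.update (fun _ => c) i b) T)
      = B.evalTrm (Function.update (fun _ => h.toFun c) i (h.toFun b)) T := by
  rw [hom_eval, upd_hom]

theorem upd_same {X : Type} {n : ℕ} (i : Fin n) (c : X) :
    Function.update (fun _ : Fin n => c) i c = fun _ => c := Function.update_eq_self i _

/-- Extraction of the position `i` and of the term `g`. -/
theorem exists_g (h : RA V) (hZ : ¬ (P.Z hT).rel P.x P.y) : ∃ (i : Fin n) (g : Trm σ (Fin 3)),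
    P.ev g (P.F.evalTrm (Function.update (fun _ => P.y) i P.x) T) P.x P.y = P.x ∧
    ¬ (P.Z hT).rel (P.ev g (P.F.evalTrm (Function.update (fun _ => P.y) i P.x) T) P.x P.y)
      (P.ev g P.y P.x P.y) := by
  have hi : ∃ i : Fin n, ¬ (P.Z hT).rel (P.F.evalTrm (Function.update (fun _ => P.x) i P.x) T)
      (P.F.evalTrm (Function.update (fun _ => P.x) i P.y) T) := by
    by_contra hcon
    push Not at hcon
    apply hZ
    have := tele (P.Z_cz hT) T (fun _ => P.x) (fun _ => P.y) (fun _ => P.th_xy)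
      (fun i => ⟨fun _ => P.x, fun _ => P.th.iseqv.refl _, hcon i⟩)
    rwa [hT.1, hT.1] at this
  obtain ⟨i, hi⟩ := hi
  refine ⟨i, ?_⟩
  have m : Mtx P.al (P.rc hT ⊔ P.rd hT)
      (P.DA.evalTrm (Function.update (fun _ => P.Zh) i P.Xh) T)
      (P.DA.evalTrm (Function.update (fun _ => P.Zh) i P.Yh) T)
      (P.DA.evalTrm (Function.update (fun _ => P.Xh) i P.Xh) T)
      (P.DA.evalTrm (Function.update (fun _ => P.Xh) i P.Yh) T) := by
    apply Mtx.eval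
    intro j
    by_cases hj : j = i
    · subst hj
      simp only [Function.update_self]
      exact .col (P.XY_sup hT)
    · simp only [Function.update_of_ne hj]
      exact .row (P.al.iseqv.symm P.XZ_al)
  have hrs : ¬ (P.al ⊓ P.rc hT).rel (P.DA.evalTrm (Function.update (fun _ => P.Xh) i P.Xh) T)
      (P.DA.evalTrm (Function.update (fun _ => P.Xh) i P.Yh) T) := by
    rw [inf_rel]
    rintro ⟨-, -, h2⟩
    have h3 := h2 (.var 0) (by
      rw [eval_upd, upd_same]
      exact hT.1 _)
    rw [eval_upd, eval_upd] at h3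
    exact hi h3
  have hpq := mt (P.ra_cz hT h _ _ _ _ m) hrs
  rw [inf_rel] at hpq
  have hal : P.al.rel (P.DA.evalTrm (Function.update (fun _ => P.Zh) i P.Xh) T)
      (P.DA.evalTrm (Function.update (fun _ => P.Zh) i P.Yh) T) := by
    apply cong_eval
    intro j
    by_cases hj : j = i
    · subst hj
      simp only [Function.update_self]
      exact P.XY_al
    · simp only [Function.update_of_ne hj]
      exact P.al.iseqv.refl _
  by_contra hcon
  push Not at hcon
  refine hpq ⟨hal, ?_, fun g hg => ?_⟩
  · rw [eval_upd, eval_upd]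
    rfl
  · rw [eval_upd] at hg
    have := hcon g hg
    rw [eval_upd, eval_upd]
    have e : P.F.evalTrm (Function.update (fun _ => P.cH.toFun P.Zh) i (P.cH.toFun P.Yh)) T
        = P.y := by
      show P.F.evalTrm (Function.update (fun _ => P.y) i P.y) T = P.y
      rw [upd_same, hT.1]
    rw [e]
    exact this

theorem Z_xy (h : RA V) : (P.Z hT).rel P.x P.y := by
  by_contra hZ
  obtain ⟨i, g, hg, hn⟩ := P.exists_g hT h hZ
  apply hn
  have hgV : ∀ A : Alg σ, V.Mem A → ∀ a b : A.carrier,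
      A.evalTrm ![A.evalTrm (Function.update (fun _ => b) i a) T, a, b] g = a := by
    intro A hA a b
    obtain ⟨φ, hx, hy⟩ := P.univ A hA a b
    have := congrArg φ.toFun hg
    rwa [hom_eval3, eval_upd, hx, hy] at this
  have hk : ∀ j, j ≠ i → (P.Z hT).rel
      (P.ev g (P.F.evalTrm (Function.update (fun _ => P.y) j P.x) T) P.y P.y)
      (P.ev g (P.F.evalTrm (Function.update (fun _ => P.y) j P.y) T) P.y P.y) := by
    intro j hj
    let k : Trm σ (Fin 3) := subst ![subst (Function.update (Function.update
      (fun _ => Trm.var 1) i (.var 2)) j (.var 0)) T, .var 2, .var 1] g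
    have ek : ∀ (A : Alg σ) (a b c : A.carrier), A.evalTrm ![a, b, c] k
        = A.evalTrm ![A.evalTrm (Function.update (Function.update (fun _ => b) i c) j a) T,
          c, b] g := by
      intro A a b c
      show A.evalTrm _ (subst _ g) = _
      rw [eval_subst3, eval_subst]
      congr 2
      congr 1
      funext l
      by_cases hl : l = j
      · subst hl; simp [Alg.evalTrm]
      · by_cases hl' : l = i
        · subst hl'; simp [hl, Alg.evalTrm]
        · simp [hl, hl', Alg.evalTrm]
    have hkk : KK V k := by
      intro A hA a b
      rw [ek]
      have : Function.update (Function.update (fun _ : Fin n => a) i b) j a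
          = Function.update (fun _ => a) i b := by
        rw [Function.update_comm hj.symm, upd_same]
      rw [this]
      exact hgV A hA b a
    have e1 : P.ev k P.x P.y P.y
        = P.ev g (P.F.evalTrm (Function.update (fun _ => P.y) j P.x) T) P.y P.y := by
      rw [ev, ek, upd_same]
    have e2 : P.ev g (P.F.evalTrm (Function.update (fun _ => P.y) j P.y) T) P.y P.y = P.y := by
      have := hgV P.F P.mem P.y P.y
      rw [upd_same] at this ⊢
      exact this
    rw [← e1, e2]
    have t := @P.th.iseqv.trans
    have s := @P.th.iseqv.symm
    refine Z.ofJ hT ?_ (s P.th_xy) ⟨k, hkk, P.ze.iseqv.refl _⟩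
    have := cong_eval3 P.th (P.th.iseqv.refl P.x) (s P.th_xy) (s P.th_xy) k
    rwa [hkk _ P.mem] at this
  have hv : ∀ v : Fin n → Bool, (P.Z hT).rel
      (P.ev g (P.F.evalTrm (fun j => cond (v j) P.x P.y) T) P.y P.y)
      (P.ev g (P.F.evalTrm (Function.update (fun _ => P.y) i (cond (v i) P.x P.y)) T) P.y P.y) := by
    intro v
    have hyv : ∀ b : Bool, P.th.rel P.y (cond b P.x P.y) := by
      intro b
      cases b
      · exact P.th.iseqv.refl _
      · exact P.th.iseqv.symm P.th_xy
    refine tele_fun (P.Z_cz hT) (fun a => P.ev g (P.F.evalTrm a T) P.y P.y) ?_ _ _ ?_ ?_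
    · intro p q r s m
      exact Mtx.eval3 g (Mtx.eval T _ _ _ _ m) (.rfl' _) (.rfl' _)
    · intro j
      by_cases hj : j = i
      · subst hj
        simp only [Function.update_self]
        exact P.th.iseqv.refl _
      · simp only [Function.update_of_ne hj]
        exact P.th.iseqv.symm (hyv _)
    · intro j
      refine ⟨fun _ => P.y, fun j => hyv _, ?_⟩
      by_cases hj : j = i
      · subst hj
        simp only [Function.update_self]
        exact (P.Z hT).iseqv.refl _
      · simp only [Function.update_of_ne hj]
        cases v j
        · exact (P.Z hT).iseqv.refl _
        · exact hk j hj
  obtain ⟨w, z, hw, hz, hwz⟩ := hT.2 i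
  have h1 := hv w
  have h2 := hv z
  rw [hwz] at h1
  have h3 := (P.Z hT).iseqv.trans ((P.Z hT).iseqv.symm h1) h2
  rw [hw, hz] at h3
  simp only [cond_true, cond_false] at h3
  rw [upd_same, hT.1] at h3
  refine P.Z_cz hT _ _ _ _ ?_ h3
  have hty : P.th.rel (P.F.evalTrm (Function.update (fun _ => P.y) i P.x) T) P.y := by
    have := cong_eval P.th (Function.update (fun _ => P.y) i P.x) (fun _ => P.y) (by
      intro j
      by_cases hj : j = i
      · subst hj
        simp only [Function.update_self]
        exact P.th_xy
      · simp only [Function.update_of_ne hj]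
        exact P.th.iseqv.refl _) T
    rwa [hT.1] at this
  exact Mtx.eval3 g (.col hty) (.row (P.th.iseqv.symm P.th_xy)) (.rfl' _)

end Fr

theorem two_one {σ : Sig} (V : Variety σ) (hT : HasTaylorTrm V) (h : RA V) :
    ∃ d : Trm σ (Fin 3), IsDifferenceTrm V d := by
  obtain ⟨n, T, hT⟩ := hT
  obtain ⟨P⟩ := exists_fr V
  exact P.diff_of_Z (tay_of hT P.mem) (P.Z_xy (tay_of hT P.mem) h)

end DT

/-- If a variety `V` has a Taylor term, then the following are equivalent:
(1) `V` has a difference term; (2) right annihilators exist throughout `V`;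
(3) the commutator is right semidistributive throughout `V`. -/
theorem difference_iff_right_annihilators_iff_right_semidistributive {σ : Sig}
    (V : Variety σ) (hT : HasTaylorTrm V) :
    List.TFAE [
      ∃ d : Trm σ (Fin 3), IsDifferenceTrm V d,
      ∀ A : Alg σ, V.Mem A → ∀ x : Congruence A,
        ∃ y : Congruence A, commC x y = ⊥ ∧
          ∀ y' : Congruence A, commC x y' = ⊥ → y' ≤ y,
      ∀ A : Alg σ, V.Mem A → ∀ x y y' : Congruence A,
        commC x y = commC x y' → commC x y = commC x (y ⊔ y') ] := by
  tfae_have 1 → 3 := DT.one_three V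
  tfae_have 3 → 2 := DT.three_two V
  tfae_have 2 → 1 := DT.two_one V hT
  tfae_finish
end

section
/- Let V be a variety that has a Taylor term. The following are equivalent: (1) V is congruence modular; (2) the centralizer relation is symmetric in its first two places throughout V, i.e., C(x,y;z) holds if and only if C(y,x;z) holds, for all congruences x, y, z on every algebra in V; (3) relative right annihilators exist throughout V, i.e., given congruences x, z on any algebra in V, there is a largest congruence y such that C(x,y;z); (4) the centralizer relation is determined by the commutator throughout V, i.e., C(x,y;z) holds if and only if [x,y] ≤ z; (5) the centralizer relation is stable under lifting in its third place throughout V, i.e., C(x,y;z) and z ≤ z' imply C(x,y;z'). -/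
namespace CM

/-- Substitution of terms for variables. -/
def sub {σ : Sig} {V W : Type} (g : V → Trm σ W) : Trm σ V → Trm σ W
  | .var v => g v
  | .op f ts => .op f fun i => sub g (ts i)

theorem eval_sub {σ : Sig} (A : Alg σ) {V W : Type} (g : V → Trm σ W) (asg : W → A.carrier)
    (t : Trm σ V) : A.evalTrm asg (sub g t) = A.evalTrm (fun v => A.evalTrm asg (g v)) t := by
  induction t with
  | var v => rfl
  | op f ts ih => simp only [sub, Alg.evalTrm, ih]

theorem eval_rel {σ : Sig} (A : Alg σ) (R : A.carrier → A.carrier → Prop)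
    (hR : ∀ (f : σ.ops) (a b : Fin (σ.arity f) → A.carrier),
      (∀ i, R (a i) (b i)) → R (A.interp f a) (A.interp f b))
    {V : Type} (p q : V → A.carrier) (h : ∀ v, R (p v) (q v)) (t : Trm σ V) :
    R (A.evalTrm p t) (A.evalTrm q t) := by
  induction t with
  | var v => exact h v
  | op f ts ih => exact hR f _ _ ih

theorem eval_cong {σ : Sig} {A : Alg σ} (c : Congruence A)
    {V : Type} (p q : V → A.carrier) (h : ∀ v, c.rel (p v) (q v)) (t : Trm σ V) :
    c.rel (A.evalTrm p t) (A.evalTrm q t) := eval_rel A c.rel c.compat p q h t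

theorem eval_algOn {σ : Sig} {A : Alg σ} (α : Congruence A) {V : Type}
    (p : V → (algOn A α).carrier) (t : Trm σ V) :
    ((algOn A α).evalTrm p t).1 =
      (A.evalTrm (fun v => (p v).1.1) t, A.evalTrm (fun v => (p v).1.2) t) := by
  induction t with
  | var v => rfl
  | op f ts ih => simp only [Alg.evalTrm, algOn] at ih ⊢; simp [ih]

/-- One coordinate at a time. -/
theorem one_by_one {X : Type} {n : ℕ} (R : (Fin n → X) → (Fin n → X) → Prop)
    (hr : ∀ a, R a a) (ht : ∀ a b c, R a b → R b c → R a c) (a b : Fin n → X)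
    (h : ∀ i (c : Fin n → X), (∀ j, c j = a j ∨ c j = b j) →
      R (Function.update c i (a i)) (Function.update c i (b i))) : R a b := by
  classical
  have key : ∀ s : Finset (Fin n), R a (fun j => if j ∈ s then b j else a j) := by
    intro s
    induction s using Finset.induction_on with
    | empty => simpa using hr a
    | insert i s hi ih =>
      refine ht _ _ _ ih ?_
      have := h i (fun j => if j ∈ s then b j else a j)
        (fun j => by by_cases hj : j ∈ s <;> simp [hj])
      convert this using 1
      · funext j
        by_cases hj : j = i
        · subst hj; simp [hi]
        · simp [hj]
      · funext j
        by_cases hj : j = i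
        · subst hj; simp
        · simp [hj]
  simpa using key Finset.univ

variable {σ : Sig} {A : Alg σ}

theorem inf_rel (c d : Congruence A) (a b : A.carrier) :
    (c ⊓ d).rel a b ↔ c.rel a b ∧ d.rel a b := by
  let e : Congruence A :=
    { rel := fun a b => c.rel a b ∧ d.rel a b
      iseqv := ⟨fun a => ⟨c.iseqv.refl a, d.iseqv.refl a⟩,
        fun h => ⟨c.iseqv.symm h.1, d.iseqv.symm h.2⟩,
        fun h k => ⟨c.iseqv.trans h.1 k.1, d.iseqv.trans h.2 k.2⟩⟩
      compat := fun f a b h => ⟨c.compat f a b fun i => (h i).1, d.compat f a b fun i => (h i).2⟩ }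
  constructor
  · intro h
    exact ⟨(inf_le_left : c ⊓ d ≤ c) a b h, (inf_le_right : c ⊓ d ≤ d) a b h⟩
  · intro h
    have h1 : e ≤ c := fun a b h => h.1
    have h2 : e ≤ d := fun a b h => h.2
    exact (le_inf h1 h2) a b h

/-- The largest congruence saturating `P`. -/
def syn (A : Alg σ) (P : A.carrier → Prop) : Congruence A where
  rel a b := ∀ (W : Type) (t : Trm σ W) (f g : W → A.carrier),
    (∀ w, f w = g w ∨ (f w = a ∧ g w = b)) → (P (A.evalTrm f t) ↔ P (A.evalTrm g t))
  iseqv := by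
    classical
    refine ⟨?_, ?_, ?_⟩
    · intro a W t f g h
      have : f = g := funext fun w => (h w).elim id fun h => h.1.trans h.2.symm
      rw [this]
    · intro a b h W t f g hfg
      refine (h W t g f fun w => ?_).symm
      rcases hfg w with h | h
      · exact Or.inl h.symm
      · exact Or.inr ⟨h.2, h.1⟩
    · intro a b c h1 h2 W t f g hfg
      have e1 := h1 W t f (fun w => if f w = g w then f w else b) (fun w => by
        by_cases hw : f w = g w
        · simp [hw]
        · rcases hfg w with h | h
          · exact absurd h hw
          · right; simp only [if_neg hw]; exact ⟨h.1, trivial⟩)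
      have e2 := h2 W t (fun w => if f w = g w then f w else b) g (fun w => by
        by_cases hw : f w = g w
        · simp [hw]
        · rcases hfg w with h | h
          · exact absurd h hw
          · right; simp only [if_neg hw]; exact ⟨trivial, h.2⟩)
      exact e1.trans e2
  compat := by
    classical
    intro k a b hab W t f g hfg
    let s : W → Trm σ (W ⊕ Fin (σ.arity k)) := fun w =>
      if f w = g w then .var (Sum.inl w) else .op k fun j => .var (Sum.inr j)
    have ef : A.evalTrm f t = A.evalTrm (Sum.elim f a) (sub s t) := by
      rw [eval_sub]; congr 1; funext w
      by_cases hw : f w = g w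
      · simp [s, hw, Alg.evalTrm]
      · rcases hfg w with h | h
        · exact absurd h hw
        · simp only [s, if_neg hw, Alg.evalTrm, Sum.elim_inr]; exact h.1
    have eg : A.evalTrm g t = A.evalTrm (Sum.elim f b) (sub s t) := by
      rw [eval_sub]; congr 1; funext w
      by_cases hw : f w = g w
      · simp [s, hw, Alg.evalTrm]
      · rcases hfg w with h | h
        · exact absurd h hw
        · simp only [s, if_neg hw, Alg.evalTrm, Sum.elim_inr]; exact h.2
    rw [ef, eg]
    refine one_by_one (fun a b => P (A.evalTrm (Sum.elim f a) (sub s t)) ↔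
      P (A.evalTrm (Sum.elim f b) (sub s t))) (fun _ => Iff.rfl) (fun _ _ _ => Iff.trans) a b ?_
    intro i c _
    refine hab i _ _ _ _ ?_
    rintro (w | j)
    · exact Or.inl rfl
    · by_cases hj : j = i
      · subst hj; right; simp
      · left; simp [hj]

theorem syn_sat (P : A.carrier → Prop) {a b : A.carrier} (h : (syn A P).rel a b) (ha : P a) :
    P b :=
  (h Unit (.var ()) (fun _ => a) (fun _ => b) (fun _ => Or.inr ⟨rfl, rfl⟩)).1 ha

theorem le_syn (P : A.carrier → Prop) (c : Congruence A)
    (h : ∀ a b, c.rel a b → P a → P b) : c ≤ syn A P := by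
  intro a b hab W t f g hfg
  have : c.rel (A.evalTrm f t) (A.evalTrm g t) := by
    refine eval_cong c f g (fun w => ?_) t
    rcases hfg w with h | h
    · rw [h]; exact c.iseqv.refl _
    · rw [h.1, h.2]; exact hab
  exact ⟨h _ _ this, h _ _ (c.iseqv.symm this)⟩

/-- Every term uses finitely many variables. -/
theorem finite_vars {W : Type} (t : Trm σ W) :
    ∃ (U : Type) (_ : Finite U) (e : U → W) (t' : Trm σ U), t = sub (fun u => .var (e u)) t' := by
  induction t with
  | var v => exact ⟨Unit, inferInstance, fun _ => v, .var (), rfl⟩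
  | op f ts ih =>
    choose U hU e t' h using ih
    refine ⟨Σ i, U i, inferInstance, fun x => e x.1 x.2,
      .op f fun i => sub (fun u => .var ⟨i, u⟩) (t' i), ?_⟩
    simp only [sub]
    congr 1
    funext i
    rw [h i]
    generalize t' i = s
    induction s with
    | var v => rfl
    | op g rs ih2 => simp only [sub]; congr 1; funext j; exact ih2 j

theorem cent_gen {x y δ : Congruence A} (h : Centralizes x y δ) {W : Type} (t : Trm σ W)
    (p q r s : W → A.carrier)
    (hw : ∀ w, (p w = q w ∧ r w = s w ∧ x.rel (p w) (r w)) ∨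
      (p w = r w ∧ q w = s w ∧ y.rel (p w) (q w)))
    (hpq : δ.rel (A.evalTrm p t) (A.evalTrm q t)) :
    δ.rel (A.evalTrm r t) (A.evalTrm s t) := by
  classical
  obtain ⟨U, hU, e, t', rfl⟩ := finite_vars t
  obtain ⟨n, ⟨φ⟩⟩ := Finite.exists_equiv_fin U
  let X : W → Prop := fun w => p w = q w ∧ r w = s w ∧ x.rel (p w) (r w)
  let T : Trm σ (Fin n ⊕ Fin n) := sub (fun u => .var
    (if X (e u) then Sum.inl (φ u) else Sum.inr (φ u))) t'
  let ι : Fin n → W := fun i => e (φ.symm i)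
  have key := h n n T (fun i => p (ι i)) (fun i => if X (ι i) then r (ι i) else p (ι i))
    (fun i => p (ι i)) (fun i => if X (ι i) then p (ι i) else q (ι i))
    (fun i => by
      by_cases hX : X (ι i)
      · simp only [if_pos hX]; exact hX.2.2
      · simp only [if_neg hX]; exact x.iseqv.refl _)
    (fun i => by
      by_cases hX : X (ι i)
      · simp only [if_pos hX]; exact y.iseqv.refl _
      · simp only [if_neg hX]
        rcases hw (ι i) with h | h
        · exact absurd h hX
        · exact h.2.2)
  have tr : ∀ (f : W → A.carrier) (g k : Fin n → A.carrier),
      (∀ u, f (e u) = if X (e u) then g (φ u) else k (φ u)) →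
      A.evalTrm (Sum.elim g k) T = A.evalTrm f (sub (fun u => .var (e u)) t') := by
    intro f g k hf
    simp only [T, eval_sub]
    congr 1
    funext u
    simp only [Alg.evalTrm, hf u]
    by_cases hX : X (e u) <;> simp [hX]
  rw [tr p, tr q, tr r, tr s] at key
  · exact key hpq
  all_goals
    intro u
    by_cases hX : X (e u)
    · have := hX
      simp only [ι, Equiv.symm_apply_apply, if_pos hX]
      try exact hX.1.symm
      try exact hX.2.1.symm
    · have := (hw (e u)).resolve_left hX
      simp only [ι, Equiv.symm_apply_apply, if_neg hX]
      try exact this.1.symm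
      try exact this.2.1.symm

/-- The diagonal predicate modulo `δ` on `A(α)`. -/
def Dh (α δ : Congruence A) (z : (algOn A α).carrier) : Prop := δ.rel z.1.1 z.1.2

/-- The largest congruence on `A(α)` saturating the `δ`-diagonal. -/
def Dl (α δ : Congruence A) : Congruence (algOn A α) := syn (algOn A α) (Dh α δ)

/-- diagonal elements -/
def dg (α : Congruence A) (a : A.carrier) : (algOn A α).carrier := ⟨(a, a), α.iseqv.refl a⟩

theorem cent_iff (x y δ : Congruence A) :
    Centralizes x y δ ↔ ∀ a b, x.rel a b → (Dl y δ).rel (dg y a) (dg y b) := by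
  constructor
  · intro h a b hab W t f g hfg
    simp only [Dh, eval_algOn]
    constructor
    · refine cent_gen h t _ _ _ _ fun w => ?_
      rcases hfg w with e | ⟨e1, e2⟩
      · right; rw [e]; exact ⟨rfl, rfl, (g w).2⟩
      · left; rw [e1, e2]; exact ⟨rfl, rfl, hab⟩
    · refine cent_gen h t _ _ _ _ fun w => ?_
      rcases hfg w with e | ⟨e1, e2⟩
      · right; rw [e]; exact ⟨rfl, rfl, (g w).2⟩
      · left; rw [e1, e2]; exact ⟨rfl, rfl, x.iseqv.symm hab⟩
  · intro h m n t a b u v hab huv hp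
    let F : (Fin m → A.carrier) → (Fin m ⊕ Fin n → (algOn A y).carrier) := fun a =>
      Sum.elim (fun i => dg y (a i)) (fun j => ⟨(u j, v j), huv j⟩)
    have e : ∀ a, ((algOn A y).evalTrm (F a) t).1 =
        (A.evalTrm (Sum.elim a u) t, A.evalTrm (Sum.elim a v) t) := by
      intro a
      rw [eval_algOn]
      congr 2 <;> (funext w; rcases w with i | j <;> rfl)
    have := syn_sat (Dh y δ) (eval_cong (Dl y δ) (F a) (F b) (by
      rintro (i | j)
      · exact h _ _ (hab i)
      · exact (Dl y δ).iseqv.refl _) t)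
    simp only [Dh, e] at this
    exact this hp

/-- left annihilator -/
def annL (y δ : Congruence A) : Congruence A where
  rel a b := (Dl y δ).rel (dg y a) (dg y b)
  iseqv := ⟨fun _ => (Dl y δ).iseqv.refl _, fun h => (Dl y δ).iseqv.symm h,
    fun h k => (Dl y δ).iseqv.trans h k⟩
  compat f a b h := (Dl y δ).compat f (fun i => dg y (a i)) (fun i => dg y (b i)) h

theorem cent_iff_le (x y δ : Congruence A) : Centralizes x y δ ↔ x ≤ annL y δ := cent_iff x y δ

theorem cent_mono_right {x y y' δ : Congruence A} (h : Centralizes x y δ) (hy : y' ≤ y) :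
    Centralizes x y' δ := fun m n t a b u v hab huv =>
  h m n t a b u v hab fun j => hy _ _ (huv j)

theorem cent_of_inf_le {S T δ : Congruence A} (h1 : δ ≤ S) (h2 : S ⊓ T ≤ δ) :
    Centralizes S T δ := by
  intro m n t a b u v hab huv hp
  refine h2 _ _ ((inf_rel _ _ _ _).2 ⟨?_, ?_⟩)
  · have e : ∀ u, S.rel (A.evalTrm (Sum.elim a u) t) (A.evalTrm (Sum.elim b u) t) := fun u =>
      eval_cong S _ _ (by
        rintro (i | j)
        · exact hab i
        · exact S.iseqv.refl _) t
    exact S.iseqv.trans (S.iseqv.symm (e u)) (S.iseqv.trans (h1 _ _ hp) (e v))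
  · exact eval_cong T _ _ (by
        rintro (i | j)
        · exact T.iseqv.refl _
        · exact huv j) t

theorem cent_left_self (T δ : Congruence A) : Centralizes δ T δ :=
  cent_of_inf_le le_rfl inf_le_left

theorem cent_right_self (S δ : Congruence A) : Centralizes S δ δ := by
  intro m n t a b u v hab huv hp
  exact eval_cong δ _ _ (by
        rintro (i | j)
        · exact δ.iseqv.refl _
        · exact huv j) t

/-- Pullback along the projections of `A(α)`. -/
def pr1 (α δ : Congruence A) : Congruence (algOn A α) where
  rel p q := δ.rel p.1.1 q.1.1
  iseqv := ⟨fun _ => δ.iseqv.refl _, fun h => δ.iseqv.symm h, fun h k => δ.iseqv.trans h k⟩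
  compat f _ _ h := δ.compat f _ _ h

/-- Pullback along the second projection of `A(α)`. -/
def pr2 (α δ : Congruence A) : Congruence (algOn A α) where
  rel p q := δ.rel p.1.2 q.1.2
  iseqv := ⟨fun _ => δ.iseqv.refl _, fun h => δ.iseqv.symm h, fun h k => δ.iseqv.trans h k⟩
  compat f _ _ h := δ.compat f _ _ h

theorem pr_le_Dl (α δ : Congruence A) : pr1 α δ ⊓ pr2 α δ ≤ Dl α δ := by
  refine le_syn _ _ fun a b hab ha => ?_
  rw [inf_rel] at hab
  exact δ.iseqv.trans (δ.iseqv.symm hab.1) (δ.iseqv.trans ha hab.2)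

theorem mem_algOn (V : Variety σ) (hA : V.Mem A) (α : Congruence A) : V.Mem (algOn A α) := by
  refine V.closed_sub (V.closed_prod (fun _ : Bool => A) fun _ => hA)
    ⟨⟨fun p b => cond b p.1.1 p.1.2, ?_⟩, ?_⟩
  · intro f a; funext b; cases b <;> rfl
  · intro p q h
    exact Subtype.ext (Prod.ext (congrFun h true) (congrFun h false))

/-- The key lemma for modular varieties. -/
theorem modular_cent (V : Variety σ) (hV : CongruenceModular V) (hA : V.Mem A)
    {α β z z' : Congruence A} (h : Centralizes β α z) (hz : z ≤ z') : Centralizes α β z' := by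
  have hB := hV _ (mem_algOn V hA α)
  intro m n t a b u v hab huv hp
  rw [cent_iff] at h
  let F : (Fin n → A.carrier) → (Fin m ⊕ Fin n → (algOn A α).carrier) := fun u =>
      Sum.elim (fun i => ⟨(a i, b i), hab i⟩) (fun j => dg α (u j))
  have e : ∀ u, ((algOn A α).evalTrm (F u) t).1 =
        (A.evalTrm (Sum.elim a u) t, A.evalTrm (Sum.elim b u) t) := by
      intro u
      rw [eval_algOn]
      congr 2 <;> (funext w; rcases w with i | j <;> rfl)
  set P := (algOn A α).evalTrm (F u) t with hP
  set Q := (algOn A α).evalTrm (F v) t with hQ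
  have hPQ : (Dl α z).rel P Q := eval_cong (Dl α z) _ _ (by
    rintro (i | j)
    · exact (Dl α z).iseqv.refl _
    · exact h _ _ (huv j)) t
  set r := A.evalTrm (Sum.elim b u) t with hr
  set s := A.evalTrm (Sum.elim b v) t with hs
  have hrs : (Dl α z).rel (dg α r) (dg α s) := h _ _ (eval_cong β _ _ (by
    rintro (i | j)
    · exact β.iseqv.refl _
    · exact huv j) t)
  let E1 := Dl α z ⊓ pr1 α z'
  let E2 := pr2 α z'
  have h1 : (E1 ⊔ E2).rel (dg α r) (dg α s) := by
    have a1 : E2.rel (dg α r) P := by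
      change z'.rel r P.1.2
      rw [e u]; exact z'.iseqv.refl _
    have a2 : E1.rel P Q := by
      refine (inf_rel _ _ _ _).2 ⟨hPQ, ?_⟩
      change z'.rel P.1.1 Q.1.1
      rw [e u, e v]; exact hp
    have a3 : E2.rel Q (dg α s) := by
      change z'.rel Q.1.2 s
      rw [e v]; exact z'.iseqv.refl _
    have l1 : E1 ≤ E1 ⊔ E2 := le_sup_left
    have l2 : E2 ≤ E1 ⊔ E2 := le_sup_right
    exact (E1 ⊔ E2).iseqv.trans (l2 _ _ a1) ((E1 ⊔ E2).iseqv.trans (l1 _ _ a2) (l2 _ _ a3))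
  have h2 : (E1 ⊔ E2 ⊓ Dl α z).rel (dg α r) (dg α s) :=
    (IsModularLattice.sup_inf_le_assoc_of_le E2 (inf_le_left : E1 ≤ Dl α z)) _ _
      ((inf_rel _ _ _ _).2 ⟨h1, hrs⟩)
  let Pr : (algOn A α).carrier → Prop := fun x => z.rel x.1.1 x.1.2 ∧ z'.rel r x.1.1
  have h3 : E1 ⊔ E2 ⊓ Dl α z ≤ syn _ Pr := by
    refine sup_le (le_syn _ _ ?_) (le_syn _ _ ?_)
    · intro x y hxy hx
      rw [inf_rel] at hxy
      have := syn_sat (Dh α z) hxy.1 hx.1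
      exact ⟨this, z'.iseqv.trans hx.2 hxy.2⟩
    · intro x y hxy hx
      rw [inf_rel] at hxy
      have := syn_sat (Dh α z) hxy.2 hx.1
      exact ⟨this, z'.iseqv.trans hx.2 (z'.iseqv.trans (hz _ _ hx.1)
        (z'.iseqv.trans hxy.1 (z'.iseqv.symm (hz _ _ this))))⟩
  exact (syn_sat Pr (h3 _ _ h2) ⟨z.iseqv.refl _, z'.iseqv.refl _⟩).2

/-- Shifting along a tolerance, using a Taylor term. -/
theorem taylor_shift {n : ℕ} (T : Trm σ (Fin n))
    (hid : ∀ c : A.carrier, A.evalTrm (fun _ => c) T = c)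
    (hTa : ∀ i : Fin n, ∃ w z : Fin n → Bool, w i ≠ z i ∧ ∀ x y : A.carrier,
      A.evalTrm (fun j => cond (w j) x y) T = A.evalTrm (fun j => cond (z j) x y) T)
    {α θ δ : Congruence A} (hδ : δ ≤ θ) (hC : Centralizes α θ δ)
    (D : A.carrier → A.carrier → Prop) (Dr : ∀ a, D a a) (Ds : ∀ a b, D a b → D b a)
    (Dc : ∀ (f : σ.ops) (a b : Fin (σ.arity f) → A.carrier),
      (∀ i, D (a i) (b i)) → D (A.interp f a) (A.interp f b))
    (Dα : ∀ a b, D a b → α.rel a b) (δα : δ ≤ α)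
    (hD : ∀ a b, D a b → θ.rel a b → δ.rel a b)
    {p q r s : A.carrier} (hrp : D r p) (hpq : δ.rel p q) (hqs : D q s) (hrs : θ.rel r s) :
    δ.rel r s := by
  have step : ∀ i (e : Fin n → A.carrier), (∀ j, e j = r ∨ e j = s) →
      δ.rel (A.evalTrm (Function.update e i r) T) (A.evalTrm (Function.update e i s) T) := by
    intro i e he
    obtain ⟨w, z, hwi, hzi, hwz⟩ : ∃ w z : Fin n → Bool, w i = true ∧ z i = false ∧
        ∀ x y : A.carrier,
          A.evalTrm (fun j => cond (w j) x y) T = A.evalTrm (fun j => cond (z j) x y) T := by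
      obtain ⟨w, z, hne, h⟩ := hTa i
      cases hw : w i <;> cases hz : z i
      · simp [hw, hz] at hne
      · exact ⟨z, w, hz, hw, fun x y => (h x y).symm⟩
      · exact ⟨w, z, hw, hz, h⟩
      · simp [hw, hz] at hne
    let c : Fin n → A.carrier := fun j => cond (w j) r p
    let c' : Fin n → A.carrier := fun j => cond (z j) r p
    have hcc : A.evalTrm c T = A.evalTrm c' T := hwz r p
    have hc : Function.update c i r = c := by
      have : c i = r := by simp [c, hwi]
      rw [← this]; exact Function.update_eq_self i c
    have hc' : c' i = p := by simp [c', hzi]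
    have b1 : δ.rel (A.evalTrm c' T) (A.evalTrm (Function.update c' i q) T) := by
      refine eval_cong δ _ _ (fun j => ?_) T
      by_cases hj : j = i
      · subst hj; simpa [hc'] using hpq
      · simpa [hj] using δ.iseqv.refl _
    have b2 : θ.rel (A.evalTrm c T) (A.evalTrm (Function.update c i s) T) := by
      nth_rewrite 1 [← hc]
      refine eval_cong θ _ _ (fun j => ?_) T
      by_cases hj : j = i
      · subst hj; simpa using hrs
      · simpa [hj] using θ.iseqv.refl _
    have b3 : D (A.evalTrm (Function.update c' i q) T) (A.evalTrm (Function.update c i s) T) := by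
      refine eval_rel A D Dc _ _ (fun j => ?_) T
      by_cases hj : j = i
      · subst hj; simpa using hqs
      · simp only [Function.update_of_ne hj, c, c']
        cases w j <;> cases z j
        · exact Dr _
        · exact hrp
        · exact Ds _ _ hrp
        · exact Dr _
    have b4 : δ.rel (A.evalTrm (Function.update c' i q) T)
        (A.evalTrm (Function.update c i s) T) := by
      refine hD _ _ b3 (θ.iseqv.trans (θ.iseqv.symm (hδ _ _ b1)) ?_)
      rw [← hcc]; exact b2
    have b5 : δ.rel (A.evalTrm (Function.update c i r) T)
        (A.evalTrm (Function.update c i s) T) := by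
      rw [hc, hcc]; exact δ.iseqv.trans b1 b4
    refine cent_gen hC T _ _ _ _ (fun j => ?_) b5
    by_cases hj : j = i
    · subst hj; right; simpa using hrs
    · left
      simp only [Function.update_of_ne hj, true_and]
      have k1 : α.rel p r := α.iseqv.symm (Dα _ _ hrp)
      have k2 : α.rel p s := α.iseqv.trans (δα _ _ hpq) (Dα _ _ hqs)
      have k3 : α.rel (c j) p := by
        simp only [c]; cases w j
        · exact α.iseqv.refl _
        · exact α.iseqv.symm k1
      rcases he j with h | h <;> rw [h]
      · exact α.iseqv.trans k3 k1
      · exact α.iseqv.trans k3 k2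
  have := one_by_one (fun a b => δ.rel (A.evalTrm a T) (A.evalTrm b T))
    (fun _ => δ.iseqv.refl _) (fun _ _ _ => δ.iseqv.trans) (fun _ => r) (fun _ => s)
    (fun i c hc => step i c hc)
  simpa [hid] using this

/-- Tolerances approximating the join. -/
def tolr (β δ : Congruence A) : ℕ → A.carrier → A.carrier → Prop
  | 0 => β.rel
  | k + 1 => fun a b => ∃ p q, tolr β δ k a p ∧ δ.rel p q ∧ tolr β δ k q b

theorem tolr_refl (β δ : Congruence A) (k : ℕ) (a : A.carrier) : tolr β δ k a a := by
  induction k with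
  | zero => exact β.iseqv.refl a
  | succ k ih => exact ⟨a, a, ih, δ.iseqv.refl a, ih⟩

theorem tolr_symm (β δ : Congruence A) (k : ℕ) : ∀ a b, tolr β δ k a b → tolr β δ k b a := by
  induction k with
  | zero => exact fun _ _ h => β.iseqv.symm h
  | succ k ih =>
    rintro a b ⟨p, q, h1, h2, h3⟩
    exact ⟨q, p, ih _ _ h3, δ.iseqv.symm h2, ih _ _ h1⟩

theorem tolr_compat (β δ : Congruence A) (k : ℕ) (f : σ.ops)
    (a b : Fin (σ.arity f) → A.carrier) (h : ∀ i, tolr β δ k (a i) (b i)) :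
    tolr β δ k (A.interp f a) (A.interp f b) := by
  induction k generalizing a b with
  | zero => exact β.compat f a b h
  | succ k ih =>
    choose p q h1 h2 h3 using h
    exact ⟨_, _, ih _ _ h1, δ.compat f p q h2, ih _ _ h3⟩

theorem tolr_mono (β δ : Congruence A) {k l : ℕ} (hkl : k ≤ l) (a b : A.carrier)
    (h : tolr β δ k a b) : tolr β δ l a b := by
  induction hkl with
  | refl => exact h
  | step _ ih => exact ⟨b, b, ih, δ.iseqv.refl b, tolr_refl β δ _ b⟩

/-- The join as a union of tolerances. -/
def joinT (β δ : Congruence A) : Congruence A where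
  rel a b := ∃ k, tolr β δ k a b
  iseqv := by
    refine ⟨fun a => ⟨0, tolr_refl β δ 0 a⟩, fun ⟨k, h⟩ => ⟨k, tolr_symm β δ k _ _ h⟩, ?_⟩
    rintro a b c ⟨k, h⟩ ⟨l, h'⟩
    exact ⟨max k l + 1, b, b, tolr_mono β δ (le_max_left k l) _ _ h, δ.iseqv.refl b,
      tolr_mono β δ (le_max_right k l) _ _ h'⟩
  compat := by
    intro f a b h
    choose k hk using h
    exact ⟨Finset.univ.sup k, tolr_compat β δ _ f a b fun i =>
      tolr_mono β δ (Finset.le_sup (Finset.mem_univ i)) _ _ (hk i)⟩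

theorem sup_le_joinT (β δ : Congruence A) : β ⊔ δ ≤ joinT β δ := by
  refine sup_le (fun a b h => ⟨0, h⟩) (fun a b h => ⟨1, a, b, β.iseqv.refl a, h, β.iseqv.refl b⟩)

theorem tolr_le_sup (β δ : Congruence A) (k : ℕ) (a b : A.carrier) (h : tolr β δ k a b) :
    (β ⊔ δ).rel a b := by
  induction k generalizing a b with
  | zero => exact (le_sup_left : β ≤ β ⊔ δ) a b h
  | succ k ih =>
    obtain ⟨p, q, h1, h2, h3⟩ := h
    exact (β ⊔ δ).iseqv.trans (ih _ _ h1)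
      ((β ⊔ δ).iseqv.trans ((le_sup_right : δ ≤ β ⊔ δ) _ _ h2) (ih _ _ h3))

/-- If every potential pentagon satisfies `C(β,θ;δ)`, then `V` is congruence modular. -/
theorem modular_of_cent (V : Variety σ) (hT : HasTaylorTrm V)
    (H : ∀ A : Alg σ, V.Mem A → ∀ β θ δ : Congruence A, δ ≤ θ → β ⊓ θ ≤ δ →
      θ ≤ β ⊔ δ → Centralizes β θ δ) : CongruenceModular V := by
  intro A hA
  obtain ⟨n, T, -, hid, hTa⟩ := hT
  refine ⟨fun {x} y {z'} hxz => ?_⟩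
  let δ := x ⊔ y ⊓ z'
  let z := z' ⊓ (y ⊔ δ)
  have hδz : δ ≤ z := le_inf (sup_le hxz inf_le_right) le_sup_right
  have hyz : y ⊓ z ≤ δ := le_trans (inf_le_inf_left y inf_le_left) le_sup_right
  have hC : Centralizes (y ⊔ δ) z δ := by
    rw [cent_iff_le]
    exact sup_le ((cent_iff_le _ _ _).1 (H A hA y z δ hδz hyz inf_le_right))
      ((cent_iff_le _ _ _).1 (cent_left_self z δ))
  have key : ∀ k a b, tolr y δ k a b → z.rel a b → δ.rel a b := by
    intro k
    induction k with
    | zero => exact fun a b h h' => hyz _ _ ((inf_rel _ _ _ _).2 ⟨h, h'⟩)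
    | succ k ih =>
      rintro a b ⟨p, q, h1, h2, h3⟩ hab
      refine taylor_shift T (hid A hA) (fun i => ?_) hδz hC (tolr y δ k) (tolr_refl y δ k)
        (tolr_symm y δ k) (tolr_compat y δ k) (tolr_le_sup y δ k) le_sup_right ih h1 h2 h3 hab
      obtain ⟨w, v, hne, h⟩ := hTa i
      exact ⟨w, v, hne, h A hA⟩
  have hle' : x ⊔ y ≤ y ⊔ δ := sup_le (le_trans le_sup_left le_sup_right) le_sup_left
  have hle : x ⊔ y ≤ joinT y δ := le_trans hle' (sup_le_joinT y δ)
  intro a b hab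
  rw [inf_rel] at hab
  obtain ⟨k, hk⟩ := hle _ _ hab.1
  exact key k a b hk ((inf_rel _ _ _ _).2 ⟨hab.2, hle' _ _ hab.1⟩)

/-- Relative right annihilators give symmetry in the situation of interest. -/
theorem cent_swap_of_ann (V : Variety σ)
    (H : ∀ A : Alg σ, V.Mem A → ∀ x z : Congruence A,
        ∃ y : Congruence A, Centralizes x y z ∧
          ∀ y' : Congruence A, Centralizes x y' z → y' ≤ y)
    (hA : V.Mem A) {α θ δ : Congruence A} (hθ : θ ≤ α) (h : Centralizes θ α δ) :
    Centralizes α θ δ := by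
  obtain ⟨y, hy, hmax⟩ := H _ (mem_algOn V hA α) (pr1 α δ) (Dl α δ ⊓ pr1 α δ)
  have m1 : Dl α δ ≤ y := hmax _ (cent_of_inf_le inf_le_right (by rw [inf_comm]))
  have m2 : pr2 α δ ≤ y := hmax _ (cent_of_inf_le inf_le_right
    (le_inf (pr_le_Dl α δ) inf_le_left))
  rw [cent_iff] at h
  intro m n t a b u v hab huv hp
  obtain ⟨G, hG⟩ : ∃ G : Fin m → (algOn A α).carrier, ∀ i, (G i).1 = (b i, a i) :=
    ⟨fun i => ⟨(b i, a i), α.iseqv.symm (hab i)⟩, fun _ => rfl⟩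
  obtain ⟨K, hK⟩ : ∃ K : Fin n → (algOn A α).carrier, ∀ j, (K j).1 = (u j, v j) :=
    ⟨fun j => ⟨(u j, v j), hθ _ _ (huv j)⟩, fun _ => rfl⟩
  have key := hy m n t G (fun i => dg α (b i)) (fun j => dg α (u j)) K
    (fun i => by simp only [pr1, hG]; exact δ.iseqv.refl _)
    (fun j => y.iseqv.trans (m1 _ _ (h _ _ (huv j)))
      (m2 (dg α (v j)) (K j) (by simp only [pr2, hK]; exact δ.iseqv.refl _)))
  have e : ∀ (f : Fin m → (algOn A α).carrier) (g : Fin n → (algOn A α).carrier),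
      ((algOn A α).evalTrm (Sum.elim f g) t).1 =
        (A.evalTrm (Sum.elim (fun i => (f i).1.1) (fun i => (g i).1.1)) t,
         A.evalTrm (Sum.elim (fun i => (f i).1.2) (fun i => (g i).1.2)) t) := by
      intro f g
      rw [eval_algOn]
      congr 2 <;> (funext w; rcases w with i | j <;> rfl)
  have k2 := key (by
    have : (pr1 α δ ⊓ pr2 α δ) ≤ Dl α δ ⊓ pr1 α δ := le_inf (pr_le_Dl α δ) inf_le_left
    refine this _ _ ((inf_rel _ _ _ _).2 ⟨?_, ?_⟩)
    · simp only [pr1, e, hG, hK]; exact δ.iseqv.refl _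
    · simp only [pr2, e, hG, hK]; exact hp)
  rw [inf_rel] at k2
  have k3 := syn_sat (Dh α δ) k2.1 (by simp only [Dh, e]; exact δ.iseqv.refl _)
  simp only [Dh, e, hK] at k3
  exact k3

end CM

/-- For a variety `V` with a Taylor term, the following are equivalent:
(1) `V` is congruence modular; (2) the centralizer relation is symmetric in
its first two places; (3) relative right annihilators exist; (4) the
centralizer relation is determined by the commutator; (5) the centralizer
relation is stable under lifting in its third place. -/
theorem modular_iff_centralizer_conditions {σ : Sig} (V : Variety σ)
    (hT : HasTaylorTrm V) :
    List.TFAE [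
      CongruenceModular V,
      ∀ A : Alg σ, V.Mem A → ∀ x y z : Congruence A,
        Centralizes x y z ↔ Centralizes y x z,
      ∀ A : Alg σ, V.Mem A → ∀ x z : Congruence A,
        ∃ y : Congruence A, Centralizes x y z ∧
          ∀ y' : Congruence A, Centralizes x y' z → y' ≤ y,
      ∀ A : Alg σ, V.Mem A → ∀ x y z : Congruence A,
        Centralizes x y z ↔ commC x y ≤ z,
      ∀ A : Alg σ, V.Mem A → ∀ x y z z' : Congruence A,
        Centralizes x y z → z ≤ z' → Centralizes x y z' ] := by
  tfae_have 1 → 2 := fun h A hA x y z =>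
    ⟨fun k => CM.modular_cent V h hA k le_rfl, fun k => CM.modular_cent V h hA k le_rfl⟩
  tfae_have 1 → 5 := fun h A hA x y z z' k hz =>
    CM.modular_cent V h hA (CM.modular_cent V h hA k le_rfl) hz
  tfae_have 2 → 1 := by
    intro h
    refine CM.modular_of_cent V hT fun A hA β θ δ h1 h2 h3 => ?_
    exact (h A hA _ _ _).1 (CM.cent_of_inf_le h1 (by rwa [inf_comm]))
  tfae_have 5 → 1 := by
    intro h
    refine CM.modular_of_cent V hT fun A hA β θ δ h1 h2 h3 => ?_
    exact h A hA _ _ _ _ (CM.cent_of_inf_le inf_le_left le_rfl) h2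
  tfae_have 2 → 3 := by
    intro h A hA x z
    refine ⟨CM.annL x z, (h A hA _ _ _).1 ((CM.cent_iff_le _ _ _).2 le_rfl), fun y' hy' => ?_⟩
    exact (CM.cent_iff_le _ _ _).1 ((h A hA _ _ _).1 hy')
  tfae_have 3 → 1 := by
    intro h
    refine CM.modular_of_cent V hT fun A hA β θ δ h1 h2 h3 => ?_
    obtain ⟨y, hy, hmax⟩ := h A hA θ δ
    have l1 : β ≤ y := hmax _ (CM.cent_of_inf_le h1 (by rwa [inf_comm]))
    have l2 : Centralizes θ (β ⊔ δ) δ :=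
      CM.cent_mono_right hy (sup_le l1 (hmax _ (CM.cent_right_self θ δ)))
    have l3 := CM.cent_swap_of_ann V h hA h3 l2
    exact (CM.cent_iff_le _ _ _).2 (le_trans le_sup_left ((CM.cent_iff_le _ _ _).1 l3))
  tfae_have 4 → 5 := by
    intro h A hA x y z z' k hz
    exact (h A hA _ _ _).2 (le_trans ((h A hA _ _ _).1 k) hz)
  tfae_have 5 → 4 := by
    intro h A hA x y z
    refine ⟨fun k => sInf_le k, fun k => h A hA x y _ z ?_ k⟩
    intro m n t a b u v hab huv hp c hc
    exact hc m n t a b u v hab huv (hp c hc)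
  tfae_finish
end
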